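/- arXiv:2409.11381 — 2 statements merged into one kernel-verified Lean document; each statement's English description precedes it below -/
import Mathlib

section
/- Under the correlated Gaussian model with parameter ε ∈ (0,1), let λ_n be a sequence with λ_n ≤ D√n for a fixed D > 0 and λ_n/n^{ε/4} → ∞, and set Y_n = X_n + (λ_n/√n)·𝟙𝟙ᵀ. Assume that Var((1/n)·Σ_{i,j=1}^n X_n(i,j)) = σ²·n^{1−ε}·(1+o(1)) as n → ∞ for some constant σ > 0. Then n^{ε/2}·(λ₁(n^{-1/2} Y_n) − λ_n − 1/λ_n) converges in distribution to a centered Gaussian with variance σ² (i.e. to σ·Z with Z standard normal). -/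
open MeasureTheory ProbabilityTheory Filter Topology
noncomputable section

/-- The largest eigenvalue of a real symmetric matrix, realised as the supremum of its set
of real eigenvalues. -/
def lam1 {n : ℕ} (A : Matrix (Fin n) (Fin n) ℝ) : ℝ :=
  sSup {t : ℝ | ∃ v : Fin n → ℝ, v ≠ 0 ∧ A.mulVec v = t • v}

/-- A finite family of real random variables is a centered (jointly) Gaussian vector:
every linear combination of the coordinates has a centered Gaussian law. -/
def IsCenteredGaussianVec {Ω : Type*} [MeasureSpace Ω] {ι : Type*} [Fintype ι]
    (X : ι → Ω → ℝ) : Prop :=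
  (∀ i, Measurable (X i)) ∧
    ∀ c : ι → ℝ, ∃ v : NNReal,
      Measure.map (fun ω => ∑ i, c i * X i ω) (volume : Measure Ω) = gaussianReal 0 v

/-- Covariance of two real random variables. -/
def pcov {Ω : Type*} [MeasureSpace Ω] (W V : Ω → ℝ) : ℝ :=
  (∫ ω, W ω * V ω) - (∫ ω, W ω) * ∫ ω, V ω

/-- Variance of a real random variable. -/
def pvar {Ω : Type*} [MeasureSpace Ω] (W : Ω → ℝ) : ℝ := pcov W W

/-- The correlated Gaussian model with parameter `ε` and constant `C`: for each `n`,
`X n` is a random symmetric `n × n` matrix whose entries `(X_{ij})_{i ≤ j}` form a centered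
Gaussian vector with unit variances and pairwise correlations bounded by `C * n ^ (-(1+ε))`. -/
structure CorrGaussian (Ω : Type*) [MeasureSpace Ω]
    (X : (n : ℕ) → Ω → Matrix (Fin n) (Fin n) ℝ) (C ε : ℝ) : Prop where
  symm : ∀ n ω, (X n ω).IsSymm
  gauss : ∀ n, IsCenteredGaussianVec fun p : Fin n × Fin n => fun ω => X n ω p.1 p.2
  var_one : ∀ n, ∀ i j : Fin n, ∫ ω, (X n ω i j) ^ 2 = 1
  corr_le : ∀ n, ∀ i j i' j' : Fin n, ¬((i, j) = (i', j') ∨ (i, j) = (j', i')) →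
    |∫ ω, X n ω i j * X n ω i' j'| ≤ C * (n : ℝ) ^ (-(1 + ε))

/-- The all-ones `n × n` matrix `𝟙𝟙ᵀ`. -/
def onesMat (n : ℕ) : Matrix (Fin n) (Fin n) ℝ := Matrix.of fun _ _ => 1

/-- The operator (spectral) norm of a real matrix, i.e. the norm of the induced map on
Euclidean space. -/
def opNorm {n : ℕ} (A : Matrix (Fin n) (Fin n) ℝ) : ℝ :=
  ‖(Matrix.toEuclideanLin A).toContinuousLinearMap‖

/-- `T n = O_P(a n)`: for every `δ > 0` there are `M > 0` and `n₀` such that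
`P(|T n| > M * a n) ≤ δ` for all `n ≥ n₀`. -/
def IsBigOP {Ω : Type*} [MeasureSpace Ω] (T : ℕ → Ω → ℝ) (a : ℕ → ℝ) : Prop :=
  ∀ δ : ℝ, 0 < δ → ∃ M : ℝ, 0 < M ∧ ∃ n₀ : ℕ, ∀ n ≥ n₀,
    (volume {ω | M * a n < |T n ω|}).toReal ≤ δ

/-- The sparse Rademacher(p) law `p δ_{-1} + (1 - 2p) δ_0 + p δ_1`. -/
def sparseRademacher (p : ℝ) : Measure ℝ :=
  ENNReal.ofReal p • Measure.dirac (-1) + ENNReal.ofReal (1 - 2 * p) • Measure.dirac 0 +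
    ENNReal.ofReal p • Measure.dirac 1

end

set_option linter.unusedSectionVars false
section rot
variable {E : Type*} [NormedAddCommGroup E] [NormedSpace ℝ E]

/-- Continuous functions of polynomial growth. -/
def PG {𝔸 : Type*} [NormedAddCommGroup 𝔸] (g : E → 𝔸) : Prop :=
  Continuous g ∧ ∃ K : ℝ, ∃ m : ℕ, 0 ≤ K ∧ ∀ z, ‖g z‖ ≤ K * (1 + ‖z‖) ^ m

lemma PG.add {𝔸 : Type*} [NormedAddCommGroup 𝔸] {f g : E → 𝔸} (hf : PG f) (hg : PG g) :
    PG (fun z => f z + g z) := by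
  obtain ⟨hfc, K, m, hK, hf⟩ := hf
  obtain ⟨hgc, K', m', hK', hg⟩ := hg
  refine ⟨hfc.add hgc, K + K', m + m', by positivity, fun z => ?_⟩
  have h1 : (1:ℝ) ≤ 1 + ‖z‖ := by linarith [norm_nonneg z]
  have h2 : (1 + ‖z‖) ^ m ≤ (1 + ‖z‖) ^ (m + m') := pow_le_pow_right₀ h1 (by omega)
  have h3 : (1 + ‖z‖) ^ m' ≤ (1 + ‖z‖) ^ (m + m') := pow_le_pow_right₀ h1 (by omega)
  calc ‖f z + g z‖ ≤ ‖f z‖ + ‖g z‖ := norm_add_le _ _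
    _ ≤ K * (1 + ‖z‖) ^ m + K' * (1 + ‖z‖) ^ m' := add_le_add (hf z) (hg z)
    _ ≤ K * (1 + ‖z‖) ^ (m + m') + K' * (1 + ‖z‖) ^ (m + m') := by gcongr
    _ = _ := by ring

lemma PG.mul {𝔸 : Type*} [NormedRing 𝔸] {f g : E → 𝔸} (hf : PG f) (hg : PG g) :
    PG (fun z => f z * g z) := by
  obtain ⟨hfc, K, m, hK, hf⟩ := hf
  obtain ⟨hgc, K', m', hK', hg⟩ := hg
  refine ⟨hfc.mul hgc, K * K', m + m', by positivity, fun z => ?_⟩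
  calc ‖f z * g z‖ ≤ ‖f z‖ * ‖g z‖ := norm_mul_le _ _
    _ ≤ (K * (1 + ‖z‖) ^ m) * (K' * (1 + ‖z‖) ^ m') := by
        gcongr
        · exact hf z
        · exact hg z
    _ = _ := by ring

lemma PG.const {𝔸 : Type*} [NormedAddCommGroup 𝔸] (c : 𝔸) : PG (fun _ : E => c) :=
  ⟨continuous_const, ‖c‖, 0, norm_nonneg _, fun z => by simp⟩

lemma PG.pow {𝔸 : Type*} [NormedRing 𝔸] {f : E → 𝔸} (hf : PG f) (k : ℕ) :
    PG (fun z => f z ^ k) := by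
  induction k with
  | zero => simpa using PG.const (1 : 𝔸)
  | succ k ih => simpa [pow_succ] using ih.mul hf

lemma PG.sum {𝔸 ι : Type*} [NormedAddCommGroup 𝔸] (s : Finset ι) {f : ι → E → 𝔸}
    (hf : ∀ i ∈ s, PG (f i)) : PG (fun z => ∑ i ∈ s, f i z) := by
  classical
  induction s using Finset.induction_on with
  | empty => simpa using PG.const (0 : 𝔸)
  | insert a s ha ih =>
    simp only [Finset.sum_insert ha]
    exact (hf a (by simp)).add (ih fun i hi => hf i (by simp [hi]))

lemma PG.clm_comp {𝔸 𝔹 : Type*} [NormedAddCommGroup 𝔸] [NormedSpace ℝ 𝔸]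
    [NormedAddCommGroup 𝔹] [NormedSpace ℝ 𝔹] (L : 𝔸 →L[ℝ] 𝔹) {f : E → 𝔸} (hf : PG f) :
    PG (fun z => L (f z)) := by
  obtain ⟨hfc, K, m, hK, hf⟩ := hf
  refine ⟨L.continuous.comp hfc, ‖L‖ * K, m, by positivity, fun z => ?_⟩
  calc ‖L (f z)‖ ≤ ‖L‖ * ‖f z‖ := L.le_opNorm _
    _ ≤ ‖L‖ * (K * (1 + ‖z‖) ^ m) := by gcongr; exact hf z
    _ = _ := by ring

lemma PG.clm {𝔹 : Type*} [NormedAddCommGroup 𝔹] [NormedSpace ℝ 𝔹] (L : E →L[ℝ] 𝔹) :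
    PG (fun z => L z) := by
  refine ⟨L.continuous, ‖L‖, 1, by positivity, fun z => ?_⟩
  calc ‖L z‖ ≤ ‖L‖ * ‖z‖ := L.le_opNorm _
    _ ≤ ‖L‖ * (1 + ‖z‖) ^ 1 := by gcongr; simp

lemma PG.fst : PG (fun z : E × E => z.1) := PG.clm (ContinuousLinearMap.fst ℝ E E)
lemma PG.snd : PG (fun z : E × E => z.2) := PG.clm (ContinuousLinearMap.snd ℝ E E)
lemma PG.neg {𝔸 : Type*} [NormedAddCommGroup 𝔸] {f : E → 𝔸} (hf : PG f) :
    PG (fun z => - f z) := by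
  obtain ⟨hfc, K, m, hK, hf⟩ := hf
  exact ⟨hfc.neg, K, m, hK, fun z => by simpa using hf z⟩

lemma norm_rotation_le (θ : ℝ) (z : E × E) :
    ‖ContinuousLinearMap.rotation θ z‖ ≤ 2 * ‖z‖ := by
  have h1 : ‖z.1‖ ≤ ‖z‖ := norm_fst_le z
  have h2 : ‖z.2‖ ≤ ‖z‖ := norm_snd_le z
  have hc := Real.abs_cos_le_one θ
  have hs := Real.abs_sin_le_one θ
  rw [ContinuousLinearMap.rotation_apply, Prod.norm_def]
  apply max_le
  · calc _ ≤ ‖Real.cos θ • z.1‖ + ‖Real.sin θ • z.2‖ := norm_add_le _ _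
      _ ≤ 1 * ‖z‖ + 1 * ‖z‖ := by
        rw [norm_smul, norm_smul, Real.norm_eq_abs, Real.norm_eq_abs]; gcongr
      _ = _ := by ring
  · calc _ ≤ ‖-Real.sin θ • z.1‖ + ‖Real.cos θ • z.2‖ := norm_add_le _ _
      _ ≤ 1 * ‖z‖ + 1 * ‖z‖ := by
        rw [norm_smul, norm_smul, norm_neg, Real.norm_eq_abs, Real.norm_eq_abs]; gcongr
      _ = _ := by ring

lemma hasDerivAt_rot1 (z : E × E) (θ : ℝ) :
    HasDerivAt (fun θ => (ContinuousLinearMap.rotation θ z).1)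
      (ContinuousLinearMap.rotation θ z).2 θ := by
  simp only [ContinuousLinearMap.rotation_apply]
  exact ((Real.hasDerivAt_cos θ).smul_const z.1).add ((Real.hasDerivAt_sin θ).smul_const z.2)

lemma hasDerivAt_rot2 (z : E × E) (θ : ℝ) :
    HasDerivAt (fun θ => (ContinuousLinearMap.rotation θ z).2)
      (-(ContinuousLinearMap.rotation θ z).1) θ := by
  simp only [ContinuousLinearMap.rotation_apply]
  have h := ((Real.hasDerivAt_sin θ).fun_neg.smul_const z.1).fun_add
    ((Real.hasDerivAt_cos θ).smul_const z.2)
  convert h using 1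
  simp only [neg_smul, neg_add]

lemma continuous_rot : Continuous (fun p : ℝ × (E × E) =>
    ContinuousLinearMap.rotation p.1 p.2) := by
  simp only [ContinuousLinearMap.rotation_apply]
  fun_prop

lemma rot_cont {G : E × E → ℝ} (hG : PG G) (z : E × E) :
    Continuous fun θ : ℝ => G (ContinuousLinearMap.rotation θ z) := by
  have h : Continuous (fun θ : ℝ => ContinuousLinearMap.rotation θ z) := by
    simp only [ContinuousLinearMap.rotation_apply]
    fun_prop
  exact Continuous.comp (g := G) hG.1 h

variable [MeasurableSpace E] [BorelSpace E] [SecondCountableTopology E] [CompleteSpace E]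

lemma PG.integrable {f : E → ℝ} (hf : PG f) (μ : Measure E) [IsGaussian μ] :
    Integrable f μ := by
  obtain ⟨hfc, K, m, hK, hf⟩ := hf
  have h0 : MemLp (fun z : E => ‖z‖) (m : ENNReal) μ :=
    (IsGaussian.memLp_id μ (m : ENNReal) (ENNReal.natCast_ne_top m)).norm
  have hc : MemLp (fun _ : E => (1:ℝ)) (m : ENNReal) μ := memLp_const (1:ℝ)
  have h1 : MemLp (fun z : E => (1 : ℝ) + ‖z‖) (m : ENNReal) μ := hc.add h0
  have h2 : Integrable (fun z : E => ‖(1 : ℝ) + ‖z‖‖ ^ m) μ := h1.integrable_norm_pow'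
  refine (h2.const_mul K).mono' hfc.aestronglyMeasurable (ae_of_all _ fun z => ?_)
  refine (hf z).trans_eq ?_
  rw [Real.norm_of_nonneg (by positivity)]

variable {μ : Measure E} [IsGaussian μ]

lemma rot_integral_eq (hμ : μ[id] = 0) {g : E × E → ℝ} (hg : PG g) (θ : ℝ) :
    ∫ z, g (ContinuousLinearMap.rotation θ z) ∂(μ.prod μ) = ∫ z, g z ∂(μ.prod μ) := by
  conv_rhs => rw [← IsGaussian.map_rotation_eq_self hμ θ]
  rw [integral_map (by fun_prop) hg.1.aestronglyMeasurable]

lemma rot_integrable_prod {g : E × E → ℝ} (hg : PG g) (T : ℝ) :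
    Integrable (fun p : ℝ × (E × E) => g (ContinuousLinearMap.rotation p.1 p.2))
      ((volume.restrict (Set.Ioc 0 T)).prod (μ.prod μ)) := by
  obtain ⟨hgc, K, m, hK, hb⟩ := hg
  have h1 : PG (fun z : E × E => K * (2 + 2 * ‖z‖) ^ m) := by
    refine ⟨by fun_prop, K * 2 ^ m, m, by positivity, fun z => ?_⟩
    rw [Real.norm_of_nonneg (by positivity), mul_assoc, ← mul_pow]
    apply le_of_eq; ring
  have h2 := h1.integrable (μ.prod μ)
  have h3 := h2.comp_snd (volume.restrict (Set.Ioc (0:ℝ) T))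
  refine h3.mono' ((hgc.comp continuous_rot).aestronglyMeasurable) (ae_of_all _ fun p => ?_)
  refine (hb _).trans ?_
  have := norm_rotation_le p.1 p.2
  have h4 : 1 + ‖ContinuousLinearMap.rotation p.1 p.2‖ ≤ 2 + 2 * ‖p.2‖ := by linarith
  gcongr

lemma rot_swap (hμ : μ[id] = 0) {g : E × E → ℝ} (hg : PG g) {T : ℝ} (hT : 0 ≤ T) :
    ∫ z, (∫ θ in (0:ℝ)..T, g (ContinuousLinearMap.rotation θ z)) ∂(μ.prod μ)
      = T * ∫ z, g z ∂(μ.prod μ) := by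
  simp_rw [intervalIntegral.integral_of_le hT]
  have := integral_integral_swap (f := fun θ z => g (ContinuousLinearMap.rotation θ z))
    (rot_integrable_prod (μ := μ) hg T)
  rw [← this]
  simp_rw [rot_integral_eq hμ hg]
  simp [hT]

/-- Gaussian integration by parts, in rotation form. -/
lemma rot_ibp (hμ : μ[id] = 0) {F G : E × E → ℝ} (hF : PG F) (hG : PG G)
    (hd : ∀ z θ, HasDerivAt (fun θ => F (ContinuousLinearMap.rotation θ z))
      (G (ContinuousLinearMap.rotation θ z)) θ) : ∫ z, G z ∂(μ.prod μ) = 0 := by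
  have h1 := rot_swap hμ hG (zero_le_one)
  have h2 : ∀ z, (∫ θ in (0:ℝ)..1, G (ContinuousLinearMap.rotation θ z))
      = F (ContinuousLinearMap.rotation 1 z) - F (ContinuousLinearMap.rotation 0 z) := fun z =>
    intervalIntegral.integral_eq_sub_of_hasDerivAt (fun θ _ => hd z θ)
      ((rot_cont hG z).intervalIntegrable _ _)
  simp_rw [h2] at h1
  have hi : ∀ θ : ℝ, Integrable (fun z => F (ContinuousLinearMap.rotation θ z)) (μ.prod μ) := by
    intro θ
    have := hF.integrable (μ.prod μ)
    rw [← IsGaussian.map_rotation_eq_self hμ θ] at this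
    exact this.comp_measurable (by fun_prop)
  rw [integral_sub (hi 1) (hi 0), rot_integral_eq hμ hF, rot_integral_eq hμ hF] at h1
  linarith

lemma sq_intervalIntegral_le {h : ℝ → ℝ} (hc : Continuous h) {T : ℝ} (hT : 0 < T) :
    (∫ θ in (0:ℝ)..T, h θ) ^ 2 ≤ T * ∫ θ in (0:ℝ)..T, h θ ^ 2 := by
  set m := (∫ θ in (0:ℝ)..T, h θ) / T with hm
  have h0 : 0 ≤ ∫ θ in (0:ℝ)..T, (h θ - m) ^ 2 :=
    intervalIntegral.integral_nonneg hT.le fun _ _ => sq_nonneg _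
  have h1 : ∫ θ in (0:ℝ)..T, (h θ - m) ^ 2
      = (∫ θ in (0:ℝ)..T, h θ ^ 2) - 2 * m * (∫ θ in (0:ℝ)..T, h θ) + T * m ^ 2 := by
    have : ∀ θ, (h θ - m) ^ 2 = h θ ^ 2 - 2 * m * h θ + m ^ 2 := fun θ => by ring
    simp_rw [this]
    rw [intervalIntegral.integral_add, intervalIntegral.integral_sub,
      intervalIntegral.integral_const_mul]
    · simp
    all_goals exact Continuous.intervalIntegrable (by fun_prop) _ _
  rw [h1] at h0
  have h2 : (∫ θ in (0:ℝ)..T, h θ) = T * m := by rw [hm]; field_simp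
  rw [h2] at h0 ⊢
  nlinarith

lemma rot_integrable_int {g : E × E → ℝ} (hg : PG g) {T : ℝ} (hT : 0 ≤ T) :
    Integrable (fun z => ∫ θ in (0:ℝ)..T, g (ContinuousLinearMap.rotation θ z)) (μ.prod μ) := by
  have h := (rot_integrable_prod (μ := μ) hg T).integral_prod_right
  refine h.congr (ae_of_all _ fun z => ?_)
  exact (intervalIntegral.integral_of_le hT).symm

lemma rot_poincare_pt {F G : E × E → ℝ} (hG : PG G)
    (hd : ∀ z θ, HasDerivAt (fun θ => F (ContinuousLinearMap.rotation θ z))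
      (G (ContinuousLinearMap.rotation θ z)) θ) {T : ℝ} (hT : 0 < T) (z : E × E) :
    (F (ContinuousLinearMap.rotation T z) - F z) ^ 2
      ≤ T * ∫ θ in (0:ℝ)..T, G (ContinuousLinearMap.rotation θ z) ^ 2 := by
  have hc := rot_cont hG z
  have h0 : ContinuousLinearMap.rotation 0 z = z := by
    simp [ContinuousLinearMap.rotation_apply]
  have h2 : (∫ θ in (0:ℝ)..T, G (ContinuousLinearMap.rotation θ z))
      = F (ContinuousLinearMap.rotation T z) - F z := by
    rw [intervalIntegral.integral_eq_sub_of_hasDerivAt (fun θ _ => hd z θ)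
      (hc.intervalIntegrable _ _), h0]
  rw [← h2]
  exact sq_intervalIntegral_le hc hT

/-- Maurey-Pisier form of the Gaussian Poincare inequality. -/
lemma rot_poincare (hμ : μ[id] = 0) {F G : E × E → ℝ} (hG : PG G)
    (hd : ∀ z θ, HasDerivAt (fun θ => F (ContinuousLinearMap.rotation θ z))
      (G (ContinuousLinearMap.rotation θ z)) θ) {T : ℝ} (hT : 0 < T)
    (hi : Integrable (fun z => (F (ContinuousLinearMap.rotation T z) - F z) ^ 2) (μ.prod μ)) :
    ∫ z, (F (ContinuousLinearMap.rotation T z) - F z) ^ 2 ∂(μ.prod μ)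
      ≤ T ^ 2 * ∫ z, G z ^ 2 ∂(μ.prod μ) := by
  have hG2 : PG (fun z => G z ^ 2) := hG.pow 2
  have h1 := rot_swap hμ hG2 hT.le
  have h3 := (rot_integrable_int (μ := μ) hG2 hT.le).const_mul T
  have h4 := integral_mono hi h3 (rot_poincare_pt hG hd hT)
  rw [integral_const_mul, h1] at h4
  calc _ ≤ _ := h4
    _ = _ := by ring
end rot
section mat
open scoped Matrix.Norms.L2Operator

abbrev Mat (n : ℕ) := Matrix (Fin n) (Fin n) ℝ

lemma symm_diag {n : ℕ} {A : Mat n} (hA : A.IsSymm) :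
    ∃ (U : Mat n) (d : Fin n → ℝ), U * U.transpose = 1 ∧ U.transpose * U = 1 ∧
      A = U * Matrix.diagonal d * U.transpose := by
  have hH : A.IsHermitian := by
    rw [Matrix.IsHermitian, Matrix.conjTranspose_eq_transpose_of_trivial]; exact hA
  have hs : star (hH.eigenvectorUnitary : Mat n) = (hH.eigenvectorUnitary : Mat n).transpose := by
    rw [Matrix.star_eq_conjTranspose, Matrix.conjTranspose_eq_transpose_of_trivial]
  refine ⟨hH.eigenvectorUnitary, hH.eigenvalues, ?_, ?_, ?_⟩
  · rw [← hs]; exact Unitary.mul_star_self_of_mem hH.eigenvectorUnitary.2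
  · rw [← hs]; exact Unitary.star_mul_self_of_mem hH.eigenvectorUnitary.2
  · conv_lhs => rw [hH.spectral_theorem]
    rw [Unitary.conjStarAlgAut_apply, ← hs]
    rfl

lemma diag_pow_conj {n : ℕ} {U : Mat n} {d : Fin n → ℝ} (h1 : U * U.transpose = 1)
    (h2 : U.transpose * U = 1)
    (q : ℕ) : (U * Matrix.diagonal d * U.transpose) ^ q
      = U * Matrix.diagonal (fun i => d i ^ q) * U.transpose := by
  induction q with
  | zero => simp [h1]
  | succ q ih =>
    rw [pow_succ, ih]
    calc U * Matrix.diagonal (fun i => d i ^ q) * U.transpose * (U * Matrix.diagonal d * U.transpose)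
        = U * Matrix.diagonal (fun i => d i ^ q) * (U.transpose * U) * Matrix.diagonal d
            * U.transpose := by simp only [Matrix.mul_assoc]
      _ = _ := by
        rw [h2, Matrix.mul_one, Matrix.mul_assoc U, Matrix.diagonal_mul_diagonal]
        simp only [pow_succ]

lemma trace_conj {n : ℕ} {U H : Mat n} (hH : H.IsSymm) (d e : Fin n → ℝ) :
    (H * (U * Matrix.diagonal d * U.transpose) * H * (U * Matrix.diagonal e * U.transpose)).trace
      = ∑ i, ∑ j, (U.transpose * H * U) i j ^ 2 * (e i * d j) := by
  set B := U.transpose * H * U with hB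
  have hBs : B.transpose = B := by
    rw [hB, Matrix.transpose_mul, Matrix.transpose_mul, Matrix.transpose_transpose, hH.eq,
      Matrix.mul_assoc]
  have h1 : (H * (U * Matrix.diagonal d * U.transpose) * H *
      (U * Matrix.diagonal e * U.transpose)).trace
      = (B * Matrix.diagonal d * B * Matrix.diagonal e).trace := by
    rw [← Matrix.mul_assoc _ _ U.transpose, Matrix.trace_mul_comm]
    simp only [hB, Matrix.mul_assoc]
  rw [h1, Matrix.trace]
  refine Finset.sum_congr rfl fun i _ => ?_
  rw [Matrix.diag_apply, Matrix.mul_diagonal, Matrix.mul_apply, Finset.sum_mul]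
  refine Finset.sum_congr rfl fun j _ => ?_
  rw [Matrix.mul_diagonal]
  have : B j i = B i j := by conv_lhs => rw [← hBs, Matrix.transpose_apply]
  rw [this]; ring

lemma pow_mixed (x y : ℝ) (q r m : ℕ) (h : q + r = 2 * m) :
    x ^ q * y ^ r + x ^ r * y ^ q ≤ x ^ (2 * m) + y ^ (2 * m) := by
  have hx := abs_nonneg x
  have hy := abs_nonneg y
  have h1 : x ^ q * y ^ r ≤ |x| ^ q * |y| ^ r := by
    rw [← abs_pow, ← abs_pow, ← abs_mul]; exact le_abs_self _
  have h2 : x ^ r * y ^ q ≤ |x| ^ r * |y| ^ q := by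
    rw [← abs_pow, ← abs_pow, ← abs_mul]; exact le_abs_self _
  have h3 : x ^ (2 * m) = |x| ^ q * |x| ^ r := by
    rw [← pow_add, h, pow_mul, pow_mul, sq_abs]
  have h4 : y ^ (2 * m) = |y| ^ q * |y| ^ r := by
    rw [← pow_add, h, pow_mul, pow_mul, sq_abs]
  have h5 : 0 ≤ (|x| ^ q - |y| ^ q) * (|x| ^ r - |y| ^ r) := by
    rcases le_total |x| |y| with hle | hle
    · exact mul_nonneg_of_nonpos_of_nonpos (sub_nonpos.2 (pow_le_pow_left₀ hx hle _))
        (sub_nonpos.2 (pow_le_pow_left₀ hx hle _))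
    · exact mul_nonneg (sub_nonneg.2 (pow_le_pow_left₀ hy hle _))
        (sub_nonneg.2 (pow_le_pow_left₀ hy hle _))
  nlinarith

/-- The trace inequality. -/
lemma trace_ineq {n : ℕ} {A H : Mat n} (hA : A.IsSymm) (hH : H.IsSymm) {q r m : ℕ}
    (h : q + r = 2 * m) :
    (H * A ^ q * H * A ^ r).trace ≤ ((H * A ^ m).transpose * (H * A ^ m)).trace := by
  have hR : ((H * A ^ m).transpose * (H * A ^ m)).trace
      = (H * A ^ 0 * H * A ^ (2 * m)).trace := by
    rw [Matrix.transpose_mul, Matrix.transpose_pow, hA.eq, hH.eq, Matrix.mul_assoc,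
      Matrix.trace_mul_comm, two_mul, pow_add, pow_zero, Matrix.mul_one]
    simp only [Matrix.mul_assoc]
  rw [hR]
  obtain ⟨U, d, h1, h2, rfl⟩ := symm_diag hA
  simp only [diag_pow_conj h1 h2]
  rw [trace_conj hH, trace_conj hH]
  set B := U.transpose * H * U with hB
  have hBs : ∀ i j, B j i = B i j := by
    intro i j
    have : B.transpose = B := by
      rw [hB, Matrix.transpose_mul, Matrix.transpose_mul, Matrix.transpose_transpose, hH.eq,
        Matrix.mul_assoc]
    conv_lhs => rw [← this, Matrix.transpose_apply]
  have key : ∀ e : Fin n → Fin n → ℝ, (∑ i, ∑ j, B i j ^ 2 * e i j)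
      = (∑ i, ∑ j, B i j ^ 2 * ((e i j + e j i) / 2)) := by
    intro e
    have : (∑ i, ∑ j, B i j ^ 2 * e i j) = ∑ i, ∑ j, B i j ^ 2 * e j i := by
      rw [Finset.sum_comm]
      simp only [hBs]
    have h3 : (∑ i, ∑ j, B i j ^ 2 * ((e i j + e j i) / 2))
      = ((∑ i, ∑ j, B i j ^ 2 * e i j) + ∑ i, ∑ j, B i j ^ 2 * e j i) / 2 := by
      rw [← Finset.sum_add_distrib, Finset.sum_div]
      refine Finset.sum_congr rfl fun i _ => ?_
      rw [← Finset.sum_add_distrib, Finset.sum_div]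
      refine Finset.sum_congr rfl fun j _ => ?_
      ring
    rw [h3, ← this]; ring
  rw [key, key (fun i j => d i ^ (2 * m) * d j ^ 0)]
  refine Finset.sum_le_sum fun i _ => Finset.sum_le_sum fun j _ => ?_
  refine mul_le_mul_of_nonneg_left ?_ (sq_nonneg _)
  have := pow_mixed (d i) (d j) q r m h
  simp only [pow_zero, mul_one]
  nlinarith

lemma dot_self_nonneg {n : ℕ} (b : Fin n → ℝ) : 0 ≤ b ⬝ᵥ b :=
  Finset.sum_nonneg fun i _ => mul_self_nonneg _

lemma dot_le {n : ℕ} (a b : Fin n → ℝ) : (a ⬝ᵥ b) ^ 2 ≤ (a ⬝ᵥ a) * (b ⬝ᵥ b) := by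
  have := Finset.sum_mul_sq_le_sq_mul_sq Finset.univ a b
  simpa [dotProduct, pow_two] using this

lemma norm_toLp_sq {n : ℕ} (b : Fin n → ℝ) : ‖(WithLp.toLp 2 b : EuclideanSpace ℝ (Fin n))‖ ^ 2
    = b ⬝ᵥ b := by
  rw [EuclideanSpace.norm_sq_eq]
  simp [dotProduct, pow_two]

lemma mulVec_dot_le {n : ℕ} (A : Mat n) (b : Fin n → ℝ) :
    (A.mulVec b) ⬝ᵥ (A.mulVec b) ≤ ‖A‖ ^ 2 * (b ⬝ᵥ b) := by
  have h := Matrix.l2_opNorm_mulVec A (WithLp.toLp 2 b)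
  rw [← norm_toLp_sq, ← norm_toLp_sq, ← mul_pow]
  exact pow_le_pow_left₀ (norm_nonneg _) h 2

lemma norm_sq_le_trace {n : ℕ} (A : Mat n) : ‖A‖ ^ 2 ≤ (A.transpose * A).trace := by
  have hT : 0 ≤ (A.transpose * A).trace := by
    rw [Matrix.trace]
    exact Finset.sum_nonneg fun _ _ => by
      rw [Matrix.diag_apply, Matrix.mul_apply]
      exact Finset.sum_nonneg fun j _ => mul_self_nonneg _
  have h : ‖A‖ ≤ Real.sqrt ((A.transpose * A).trace) := by
    rw [Matrix.cstar_norm_def]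
    refine ContinuousLinearMap.opNorm_le_bound _ (Real.sqrt_nonneg _) fun x => ?_
    refine abs_le_of_sq_le_sq' ?_ (by positivity) |>.2
    rw [mul_pow, Real.sq_sqrt hT]
    have e1 : (Matrix.toEuclideanCLM (n := Fin n) (𝕜 := ℝ) A) x
        = WithLp.toLp 2 (A.mulVec x.ofLp) := by
      rw [← Matrix.toEuclideanCLM_toLp]
    have e3 : ‖x‖ ^ 2 = x.ofLp ⬝ᵥ x.ofLp := norm_toLp_sq x.ofLp
    rw [e1, norm_toLp_sq, e3]
    have e2 : (A.transpose * A).trace = ∑ i, (A i) ⬝ᵥ (A i) := by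
      simp only [Matrix.trace, Matrix.diag_apply, Matrix.mul_apply, dotProduct,
        Matrix.transpose_apply]
      rw [Finset.sum_comm]
    rw [e2, Finset.sum_mul]
    rw [dotProduct]
    refine Finset.sum_le_sum fun i _ => ?_
    rw [← pow_two]
    exact dot_le (A i) x.ofLp
  calc ‖A‖ ^ 2 ≤ (Real.sqrt ((A.transpose * A).trace)) ^ 2 :=
        pow_le_pow_left₀ (norm_nonneg _) h 2
    _ = _ := Real.sq_sqrt hT

lemma norm_pow_le_trace {n : ℕ} {A : Mat n} (hA : A.IsSymm) (k : ℕ) :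
    ‖A‖ ^ (2 * 2 ^ k) ≤ (A ^ (2 * 2 ^ k)).trace := by
  have hsa : IsSelfAdjoint A := by
    rw [IsSelfAdjoint, Matrix.star_eq_conjTranspose, Matrix.conjTranspose_eq_transpose_of_trivial]
    exact hA
  have h1 : ‖A ^ 2 ^ k‖ = ‖A‖ ^ 2 ^ k := by
    have := hsa.nnnorm_pow_two_pow k
    simpa using congrArg NNReal.toReal this
  have h2 := norm_sq_le_trace (A ^ 2 ^ k)
  rw [Matrix.transpose_pow, hA.eq, ← pow_add, h1, ← pow_mul, ← mul_two] at h2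
  rwa [mul_comm 2 (2 ^ k)]

/-- The Borel sigma-algebra on matrices. -/
@[reducible] def matMS (n : ℕ) : MeasurableSpace (Mat n) := borel _
attribute [local instance] matMS
lemma matBorel (n : ℕ) : BorelSpace (Mat n) := ⟨rfl⟩
attribute [local instance] matBorel

noncomputable def trCLM (n : ℕ) : Mat n →L[ℝ] ℝ :=
  (Matrix.traceLinearMap (Fin n) ℝ ℝ).toContinuousLinearMap

lemma trCLM_apply {n : ℕ} (A : Mat n) : trCLM n A = A.trace := rfl

noncomputable def trspCLM (n : ℕ) : Mat n →L[ℝ] Mat n :=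
  (Matrix.transposeLinearEquiv (Fin n) (Fin n) ℝ ℝ).toLinearMap.toContinuousLinearMap

lemma trspCLM_apply {n : ℕ} (A : Mat n) : trspCLM n A = A.transpose := rfl

/-- The linear functional `x ↦ ⟨a, x b⟩`. -/
noncomputable def bilCLM {n : ℕ} (a b : Fin n → ℝ) : Mat n →L[ℝ] ℝ :=
  LinearMap.toContinuousLinearMap
    { toFun := fun x => a ⬝ᵥ (x.mulVec b)
      map_add' := fun x y => by simp [Matrix.add_mulVec, dotProduct_add]
      map_smul' := fun c x => by simp [Matrix.smul_mulVec, dotProduct_smul] }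

lemma bilCLM_apply {n : ℕ} (a b : Fin n → ℝ) (A : Mat n) : bilCLM a b A = a ⬝ᵥ (A.mulVec b) := rfl

/-- A centered Gaussian random symmetric matrix law, with variance bounds. -/
structure GM {n : ℕ} (μ : Measure (Mat n)) (c κ : ℝ) : Prop where
  gauss : IsGaussian μ
  cent : μ[id] = 0
  symm : ∀ᵐ x ∂μ, Matrix.IsSymm x
  hc : ∀ b : Fin n → ℝ, ∫ x, (x.mulVec b) ⬝ᵥ (x.mulVec b) ∂μ ≤ c * (b ⬝ᵥ b)
  hκ : ∀ a b : Fin n → ℝ, ∫ x, (a ⬝ᵥ (x.mulVec b)) ^ 2 ∂μ ≤ κ * ((a ⬝ᵥ a) * (b ⬝ᵥ b))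

lemma trace_tr_mul {n : ℕ} (H B : Mat n) :
    ((H * B).transpose * (H * B)).trace
      = ∑ j, (H.mulVec (B.col j)) ⬝ᵥ (H.mulVec (B.col j)) := by
  simp only [Matrix.trace, Matrix.diag_apply, Matrix.mul_apply, dotProduct,
        Matrix.transpose_apply, Matrix.mulVec, Matrix.col_apply]

lemma PG.dotmv {n : ℕ} (b : Fin n → ℝ) :
    PG (fun x : Mat n => (x.mulVec b) ⬝ᵥ (x.mulVec b)) := by
  have : ∀ x : Mat n, (x.mulVec b) ⬝ᵥ (x.mulVec b) = bilCLM b b (trspCLM n x * x) := by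
    intro x
    rw [bilCLM_apply, trspCLM_apply, ← Matrix.mulVec_mulVec, Matrix.dotProduct_mulVec b,
      Matrix.vecMul_transpose]
  simp_rw [this]
  exact ((PG.clm (trspCLM n)).mul (PG.clm (ContinuousLinearMap.id ℝ _))).clm_comp _

lemma gm_trace_step {n : ℕ} {μ : Measure (Mat n)} {c κ : ℝ} (h : GM μ c κ) (m : ℕ) :
    ∫ x, (x ^ (2 * m + 2)).trace ∂μ ≤ (2 * m + 1) * c * ∫ x, (x ^ (2 * m)).trace ∂μ := by
  have := h.gauss
  -- the functions
  set F : Mat n × Mat n → ℝ := fun z => trCLM n (z.2 * z.1 ^ (2 * m + 1)) with hF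
  set S : Mat n × Mat n → ℝ := fun z => trCLM n (z.2 *
    ∑ i ∈ Finset.range (2 * m + 1), z.1 ^ (2 * m - i) * z.2 * z.1 ^ i) with hS
  set P : Mat n × Mat n → ℝ := fun z => trCLM n (z.1 ^ (2 * m + 2)) with hP
  set Q : Mat n × Mat n → ℝ := fun z => trCLM n (trspCLM n (z.2 * z.1 ^ m) * (z.2 * z.1 ^ m))
    with hQ
  have pF : PG F := (PG.snd.mul (PG.fst.pow _)).clm_comp _
  have pS : PG S := (PG.snd.mul (PG.sum _ fun i _ =>
    ((PG.fst.pow _).mul PG.snd).mul (PG.fst.pow _))).clm_comp _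
  have pP : PG P := (PG.fst.pow _).clm_comp _
  have pQ : PG Q := (((PG.snd.mul (PG.fst.pow _)).clm_comp _).mul
    (PG.snd.mul (PG.fst.pow _))).clm_comp _
  have hibp : ∫ z, (-P z + S z) ∂(μ.prod μ) = 0 := by
    refine rot_ibp h.cent pF (pP.neg.add pS) fun z θ => ?_
    have d1 := hasDerivAt_rot1 z θ
    have d2 := hasDerivAt_rot2 z θ
    have d3 := (trCLM n).hasFDerivAt.comp_hasDerivAt θ (d2.fun_mul (d1.pow' (2 * m + 1)))
    refine d3.congr_deriv ?_
    simp only [hP, hS, map_add, Pi.pow_apply, Nat.pred_succ]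
    congr 1
    rw [neg_mul, map_neg, ← pow_succ']
  have hsym1 : ∀ᵐ z ∂(μ.prod μ), Matrix.IsSymm z.1 := Measure.quasiMeasurePreserving_fst.ae h.symm
  have hsym2 : ∀ᵐ z ∂(μ.prod μ), Matrix.IsSymm z.2 := Measure.quasiMeasurePreserving_snd.ae h.symm
  have hSQ : ∫ z, S z ∂(μ.prod μ) ≤ ∫ z, (2 * m + 1) * Q z ∂(μ.prod μ) := by
    refine integral_mono_ae (pS.integrable _) ((pQ.integrable _).const_mul _) ?_
    filter_upwards [hsym1, hsym2] with z h1 h2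
    simp only [hS, hQ, trCLM_apply, trspCLM_apply]
    rw [Finset.mul_sum, Matrix.trace_sum]
    have : ∀ i ∈ Finset.range (2 * m + 1), (z.2 * (z.1 ^ (2 * m - i) * z.2 * z.1 ^ i)).trace
        ≤ ((z.2 * z.1 ^ m).transpose * (z.2 * z.1 ^ m)).trace := by
      intro i hi
      rw [Finset.mem_range] at hi
      rw [← mul_assoc, ← mul_assoc]
      exact trace_ineq h1 h2 (by omega)
    refine (Finset.sum_le_card_nsmul _ _ _ this).trans_eq ?_
    simp
  have hQ2 : ∫ z, Q z ∂(μ.prod μ) ≤ c * ∫ x, (x ^ (2 * m)).trace ∂μ := by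
    rw [integral_prod _ (pQ.integrable _), ← integral_const_mul]
    refine integral_mono_ae (pQ.integrable (μ.prod μ)).integral_prod_left
      ((((PG.clm (ContinuousLinearMap.id ℝ (Mat n))).pow (2 * m)).clm_comp (trCLM n)).integrable
        μ |>.const_mul c) ?_
    filter_upwards [h.symm] with x hx
    simp only [hQ, trCLM_apply, trspCLM_apply, trace_tr_mul]
    rw [integral_finsetSum _ fun j _ => (PG.dotmv _).integrable μ]
    calc _ ≤ ∑ j, c * ((x ^ m).col j ⬝ᵥ (x ^ m).col j) := Finset.sum_le_sum fun j _ => h.hc _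
      _ = c * ((x ^ m).transpose * x ^ m).trace := by
        rw [← Finset.mul_sum]; rfl
      _ = c * (x ^ (2 * m)).trace := by
        rw [Matrix.transpose_pow, hx.eq, ← pow_add, two_mul]
  have hPint : ∫ z, P z ∂(μ.prod μ) = ∫ x, (x ^ (2 * m + 2)).trace ∂μ := by
    rw [integral_prod _ (pP.integrable _)]
    simp [hP, trCLM_apply]
  rw [integral_add (pP.neg.integrable _) (pS.integrable _), integral_neg] at hibp
  rw [integral_const_mul] at hSQ
  rw [← hPint]
  have : (0:ℝ) ≤ 2 * m + 1 := by positivity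
  nlinarith

lemma gm_trace {n : ℕ} {μ : Measure (Mat n)} {c κ : ℝ} (h : GM μ c κ) (hc : 0 ≤ c) (m : ℕ) :
    ∫ x, (x ^ (2 * m)).trace ∂μ ≤ ((2 * m + 1) * c) ^ m * n := by
  have := h.gauss
  induction m with
  | zero => simp
  | succ m ih =>
    have h1 := gm_trace_step h m
    rw [show 2 * (m + 1) = 2 * m + 2 by ring]
    refine h1.trans ?_
    calc (2 * m + 1) * c * ∫ x, (x ^ (2 * m)).trace ∂μ
        ≤ (2 * m + 1) * c * (((2 * m + 1) * c) ^ m * n) := by gcongr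
      _ = ((2 * m + 1) * c) ^ (m + 1) * n := by ring
      _ ≤ _ := by gcongr; linarith

lemma PG.nrm {n : ℕ} (k : ℕ) : PG (fun x : Mat n => ‖x‖ ^ k) := by
  refine ⟨by fun_prop, 1, k, zero_le_one, fun z => ?_⟩
  rw [Real.norm_of_nonneg (by positivity), one_mul]
  exact pow_le_pow_left₀ (norm_nonneg _) (by linarith) k

lemma gm_norm {n : ℕ} {μ : Measure (Mat n)} {c κ : ℝ} (h : GM μ c κ) (hc : 0 ≤ c) (k : ℕ) :
    ∫ x, ‖x‖ ^ (2 * 2 ^ k) ∂μ ≤ ((2 * 2 ^ k + 1) * c) ^ (2 ^ k) * n := by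
  have := h.gauss
  have h1 := gm_trace h hc (2 ^ k)
  push_cast at h1
  refine le_trans ?_ h1
  refine integral_mono_ae ((PG.nrm _).integrable μ)
    ((((PG.clm (ContinuousLinearMap.id ℝ (Mat n))).pow _).clm_comp (trCLM n)).integrable μ) ?_
  filter_upwards [h.symm] with x hx
  exact norm_pow_le_trace hx k

lemma norm_one_mat_le (n : ℕ) : ‖(1 : Mat n)‖ ≤ 1 := by
  rw [Matrix.cstar_norm_def, map_one]
  exact ContinuousLinearMap.norm_id_le

lemma bil_mul {n : ℕ} (u v : Fin n → ℝ) (A B C : Mat n) :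
    bilCLM u v (A * B * C) = bilCLM (A.transpose.mulVec u) (C.mulVec v) B := by
  rw [bilCLM_apply, bilCLM_apply, ← Matrix.mulVec_mulVec, ← Matrix.mulVec_mulVec,
    Matrix.dotProduct_mulVec u, Matrix.mulVec_transpose]

lemma gm_inner {n : ℕ} {μ : Measure (Mat n)} {c κ : ℝ} (h : GM μ c κ) (hκ : 0 ≤ κ)
    (u v : Fin n → ℝ) (hu : u ⬝ᵥ u = 1) (hv : v ⬝ᵥ v = 1) {A C : Mat n} (hA : A.IsSymm) :
    ∫ y, (bilCLM u v (A * y * C)) ^ 2 ∂μ ≤ κ * (‖A‖ ^ 2 * ‖C‖ ^ 2) := by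
  simp_rw [bil_mul, hA.eq]
  refine (h.hκ _ _).trans ?_
  have h1 := mulVec_dot_le A u
  have h2 := mulVec_dot_le C v
  rw [hu, mul_one] at h1
  rw [hv, mul_one] at h2
  have h3 := dot_self_nonneg (C.mulVec v)
  gcongr

lemma gm_var_int {n : ℕ} {μ : Measure (Mat n)} [IsGaussian μ] {f : Mat n → ℝ} (hf : PG f) :
    ∫ z, (f z.2 - f z.1) ^ 2 ∂(μ.prod μ) = 2 * ∫ x, (f x - ∫ y, f y ∂μ) ^ 2 ∂μ := by
  set e := ∫ y, f y ∂μ with he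
  have i1 := hf.integrable μ
  have i2 : Integrable (fun x => f x ^ 2) μ := (hf.pow 2).integrable μ
  have h2 : ∫ x, (f x - e) ^ 2 ∂μ = ∫ x, f x ^ 2 ∂μ - e ^ 2 := by
    have : ∀ x, (f x - e) ^ 2 = f x ^ 2 - (2 * e) * f x + e ^ 2 := fun x => by ring
    simp_rw [this]
    rw [integral_add (by exact i2.sub (i1.const_mul _)) (integrable_const _),
      integral_sub i2 (i1.const_mul _), integral_const_mul, ← he]
    simp; ring
  have : ∀ z : Mat n × Mat n, (f z.2 - f z.1) ^ 2
    = f z.2 ^ 2 + f z.1 ^ 2 - 2 * (f z.1 * f z.2) := fun z => by ring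
  simp_rw [this]
  rw [integral_sub, integral_add, integral_const_mul, integral_prod_mul f f,
    integral_fun_fst (fun x => f x ^ 2), integral_fun_snd (fun x => f x ^ 2), h2, ← he]
  · simp; ring
  · exact i2.comp_snd μ
  · exact i2.comp_fst μ
  · exact (i2.comp_snd μ).add (i2.comp_fst μ)
  · exact (i1.mul_prod i1).const_mul 2

/-- fluctuation of `⟨u, x² u⟩` -/
lemma gm_var2 {n : ℕ} {μ : Measure (Mat n)} {c κ : ℝ} (h : GM μ c κ) (hκ : 0 ≤ κ)
    (u : Fin n → ℝ) (hu : u ⬝ᵥ u = 1) :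
    ∫ x, (bilCLM u u (x * x) - ∫ y, bilCLM u u (y * y) ∂μ) ^ 2 ∂μ
      ≤ 8 * κ * ∫ x, ‖x‖ ^ 2 ∂μ := by
  have := h.gauss
  have pid : PG (fun x : Mat n => x) := PG.clm (ContinuousLinearMap.id ℝ (Mat n))
  have pf : PG (fun x : Mat n => bilCLM u u (x * x)) := (pid.mul pid).clm_comp _
  set G : Mat n × Mat n → ℝ := fun z => bilCLM u u (z.2 * z.1 + z.1 * z.2) with hG
  have pG : PG G := ((PG.snd.mul PG.fst).add (PG.fst.mul PG.snd)).clm_comp _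
  set F : Mat n × Mat n → ℝ := fun z => bilCLM u u (z.1 * z.1) with hF
  have pF1 : PG F := (PG.fst.mul PG.fst).clm_comp _
  have pF2 : PG (fun z : Mat n × Mat n => bilCLM u u (z.2 * z.2)) := (PG.snd.mul PG.snd).clm_comp _
  have hrot : ∀ z, F (ContinuousLinearMap.rotation (Real.pi / 2) z) = bilCLM u u (z.2 * z.2) := by
    intro z; simp [hF, ContinuousLinearMap.rotation_apply]
  have hpo := rot_poincare (μ := μ) h.cent (F := F) pG (fun z θ => by
    have d1 := hasDerivAt_rot1 z θ
    exact (bilCLM u u).hasFDerivAt.comp_hasDerivAt θ (d1.fun_mul d1)) (T := Real.pi / 2)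
    (by positivity) (by
      simp_rw [hrot, sub_eq_add_neg]
      exact ((pF2.add pF1.neg).pow 2).integrable _)
  simp_rw [hrot] at hpo
  rw [hF, gm_var_int pf] at hpo
  have hGi : ∫ z, G z ^ 2 ∂(μ.prod μ) ≤ 4 * κ * ∫ x, ‖x‖ ^ 2 ∂μ := by
    rw [integral_prod _ ((pG.pow 2).integrable _), ← integral_const_mul]
    refine integral_mono_ae ((pG.pow 2).integrable (μ.prod μ)).integral_prod_left
      (((PG.nrm 2).integrable μ).const_mul _) ?_
    filter_upwards [h.symm] with x hx
    have e1 := gm_inner h hκ u u hu hu (A := 1) (C := x) Matrix.isSymm_one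
    have e2 := gm_inner h hκ u u hu hu (A := x) (C := 1) hx
    have n1 : ‖(1 : Mat n)‖ ≤ 1 := norm_one_mat_le n
    have p1 : PG (fun y : Mat n => bilCLM u u (1 * y * x) ^ 2) :=
      ((((PG.const 1).mul pid).mul (PG.const x)).clm_comp _).pow 2
    have p2 : PG (fun y : Mat n => bilCLM u u (x * y * 1) ^ 2) :=
      ((((PG.const x).mul pid).mul (PG.const 1)).clm_comp _).pow 2
    calc ∫ y, G (x, y) ^ 2 ∂μ
        ≤ ∫ y, (2 * bilCLM u u (1 * y * x) ^ 2 + 2 * bilCLM u u (x * y * 1) ^ 2) ∂μ := by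
          refine integral_mono (PG.integrable ?_ μ)
            (((p1.integrable μ).const_mul 2).add ((p2.integrable μ).const_mul 2)) fun y => ?_
          · exact (((pid.mul (PG.const x)).add ((PG.const x).mul pid)).clm_comp _).pow 2
          · simp only [hG, one_mul, mul_one, map_add]
            nlinarith [sq_nonneg (bilCLM u u (y * x) - bilCLM u u (x * y))]
      _ = 2 * ∫ y, bilCLM u u (1 * y * x) ^ 2 ∂μ + 2 * ∫ y, bilCLM u u (x * y * 1) ^ 2 ∂μ := by
          rw [integral_add ((p1.integrable μ).const_mul 2) ((p2.integrable μ).const_mul 2),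
            integral_const_mul, integral_const_mul]
      _ ≤ 2 * (κ * (1 ^ 2 * ‖x‖ ^ 2)) + 2 * (κ * (‖x‖ ^ 2 * 1 ^ 2)) := by
          refine add_le_add (mul_le_mul_of_nonneg_left (e1.trans ?_) (by norm_num))
            (mul_le_mul_of_nonneg_left (e2.trans ?_) (by norm_num)) <;> gcongr
      _ = 4 * κ * ‖x‖ ^ 2 := by ring
  have hn : 0 ≤ κ * ∫ x, ‖x‖ ^ 2 ∂μ := mul_nonneg hκ (integral_nonneg fun x => by positivity)
  have hpi : (Real.pi / 2) ^ 2 ≤ 4 := by nlinarith [Real.pi_lt_four, Real.pi_pos]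
  have h5 : (Real.pi / 2) ^ 2 * ∫ z, G z ^ 2 ∂(μ.prod μ) ≤ 4 * (4 * κ * ∫ x, ‖x‖ ^ 2 ∂μ) := by
    gcongr
  linarith

/-- size of `⟨u, x³ u⟩` -/
lemma gm_var3 {n : ℕ} {μ : Measure (Mat n)} {c κ : ℝ} (h : GM μ c κ) (hκ : 0 ≤ κ)
    (u : Fin n → ℝ) (hu : u ⬝ᵥ u = 1) :
    ∫ x, (bilCLM u u (x * x * x)) ^ 2 ∂μ ≤ 36 * κ * ∫ x, ‖x‖ ^ 4 ∂μ := by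
  have := h.gauss
  have pid : PG (fun x : Mat n => x) := PG.clm (ContinuousLinearMap.id ℝ (Mat n))
  have pf : PG (fun x : Mat n => bilCLM u u (x * x * x)) := ((pid.mul pid).mul pid).clm_comp _
  set G : Mat n × Mat n → ℝ := fun z =>
    bilCLM u u ((z.2 * z.1 + z.1 * z.2) * z.1 + z.1 * z.1 * z.2) with hG
  have pG : PG G := ((((PG.snd.mul PG.fst).add (PG.fst.mul PG.snd)).mul PG.fst).add
    ((PG.fst.mul PG.fst).mul PG.snd)).clm_comp _
  set F : Mat n × Mat n → ℝ := fun z => bilCLM u u (z.1 * z.1 * z.1) with hF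
  have pF1 : PG F := ((PG.fst.mul PG.fst).mul PG.fst).clm_comp _
  have hrot : ∀ z, (F (ContinuousLinearMap.rotation Real.pi z) - F z) ^ 2 = 4 * F z ^ 2 := by
    intro z; simp [hF, ContinuousLinearMap.rotation_apply]; ring
  have hpo := rot_poincare (μ := μ) h.cent (F := F) pG (fun z θ => by
    have d1 := hasDerivAt_rot1 z θ
    exact (bilCLM u u).hasFDerivAt.comp_hasDerivAt θ ((d1.fun_mul d1).fun_mul d1)) (T := Real.pi)
    (by positivity) (by
      simp_rw [hrot]
      exact ((pF1.pow 2).integrable _).const_mul 4)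
  simp_rw [hrot] at hpo
  rw [integral_const_mul] at hpo
  have hFi : ∫ z, F z ^ 2 ∂(μ.prod μ) = ∫ x, (bilCLM u u (x * x * x)) ^ 2 ∂μ := by
    rw [integral_prod _ ((pF1.pow 2).integrable _)]
    simp [hF]
  have hGi : ∫ z, G z ^ 2 ∂(μ.prod μ) ≤ 9 * κ * ∫ x, ‖x‖ ^ 4 ∂μ := by
    rw [integral_prod _ ((pG.pow 2).integrable _), ← integral_const_mul]
    refine integral_mono_ae ((pG.pow 2).integrable (μ.prod μ)).integral_prod_left
      (((PG.nrm 4).integrable μ).const_mul _) ?_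
    filter_upwards [h.symm] with x hx
    have e1 := gm_inner h hκ u u hu hu (A := 1) (C := x * x) Matrix.isSymm_one
    have e2 := gm_inner h hκ u u hu hu (A := x) (C := x) hx
    have hxx : (x * x).IsSymm := by
      rw [Matrix.IsSymm, Matrix.transpose_mul, hx.eq]
    have e3 := gm_inner h hκ u u hu hu (A := x * x) (C := 1) hxx
    have n1 : ‖(1 : Mat n)‖ ≤ 1 := norm_one_mat_le n
    have n2 : ‖x * x‖ ≤ ‖x‖ * ‖x‖ := norm_mul_le _ _
    have p1 : PG (fun y : Mat n => bilCLM u u (1 * y * (x * x)) ^ 2) :=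
      ((((PG.const 1).mul pid).mul (PG.const (x * x))).clm_comp _).pow 2
    have p2 : PG (fun y : Mat n => bilCLM u u (x * y * x) ^ 2) :=
      ((((PG.const x).mul pid).mul (PG.const x)).clm_comp _).pow 2
    have p3 : PG (fun y : Mat n => bilCLM u u (x * x * y * 1) ^ 2) :=
      ((((PG.const (x * x)).mul pid).mul (PG.const 1)).clm_comp _).pow 2
    have i1 := (p1.integrable μ).const_mul 3
    have i2 := (p2.integrable μ).const_mul 3
    have i3 := (p3.integrable μ).const_mul 3
    calc ∫ y, G (x, y) ^ 2 ∂μ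
        ≤ ∫ y, (3 * bilCLM u u (1 * y * (x * x)) ^ 2 + 3 * bilCLM u u (x * y * x) ^ 2
            + 3 * bilCLM u u (x * x * y * 1) ^ 2) ∂μ := by
          refine integral_mono (PG.integrable ?_ μ) ((i1.add i2).add i3) fun y => ?_
          · exact (((((pid.mul (PG.const x)).add ((PG.const x).mul pid)).mul (PG.const x)).add
              (((PG.const x).mul (PG.const x)).mul pid)).clm_comp _).pow 2
          · simp only [hG, one_mul, mul_one, map_add, add_mul, mul_assoc]
            nlinarith [sq_nonneg (bilCLM u u (y * (x * x)) - bilCLM u u (x * (y * x))),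
              sq_nonneg (bilCLM u u (y * (x * x)) - bilCLM u u (x * (x * y))),
              sq_nonneg (bilCLM u u (x * (y * x)) - bilCLM u u (x * (x * y)))]
      _ = 3 * ∫ y, bilCLM u u (1 * y * (x * x)) ^ 2 ∂μ + 3 * ∫ y, bilCLM u u (x * y * x) ^ 2 ∂μ
            + 3 * ∫ y, bilCLM u u (x * x * y * 1) ^ 2 ∂μ := by
          rw [integral_add (by exact i1.add i2) i3, integral_add i1 i2,
            integral_const_mul, integral_const_mul, integral_const_mul]
      _ ≤ 3 * (κ * (1 ^ 2 * (‖x‖ * ‖x‖) ^ 2)) + 3 * (κ * (‖x‖ ^ 2 * ‖x‖ ^ 2))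
            + 3 * (κ * ((‖x‖ * ‖x‖) ^ 2 * 1 ^ 2)) := by
          refine add_le_add (add_le_add (mul_le_mul_of_nonneg_left (e1.trans ?_) (by norm_num))
            (mul_le_mul_of_nonneg_left e2 (by norm_num)))
            (mul_le_mul_of_nonneg_left (e3.trans ?_) (by norm_num)) <;> gcongr
      _ = 9 * κ * ‖x‖ ^ 4 := by ring
  have hn : 0 ≤ κ * ∫ x, ‖x‖ ^ 4 ∂μ := mul_nonneg hκ (integral_nonneg fun x => by positivity)
  have hpi : Real.pi ^ 2 ≤ 16 := by nlinarith [Real.pi_lt_four, Real.pi_pos]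
  have h5 : Real.pi ^ 2 * ∫ z, G z ^ 2 ∂(μ.prod μ) ≤ 16 * (9 * κ * ∫ x, ‖x‖ ^ 4 ∂μ) := by
    gcongr
  rw [hFi] at hpo
  linarith
end mat
section det
open scoped Matrix.Norms.L2Operator

lemma lam1_spec {n : ℕ} (hn : 0 < n) {A : Mat n} (hA : A.IsSymm) :
    (∃ v : Fin n → ℝ, v ≠ 0 ∧ A.mulVec v = lam1 A • v) ∧
      ∀ w : Fin n → ℝ, w ⬝ᵥ A.mulVec w ≤ lam1 A * (w ⬝ᵥ w) := by
  obtain ⟨U, d, h1, h2, hAe⟩ := symm_diag hA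
  have hS : {t : ℝ | ∃ v : Fin n → ℝ, v ≠ 0 ∧ A.mulVec v = t • v} = Set.range d := by
    ext t
    constructor
    · rintro ⟨v, hv, hAv⟩
      set w := U.transpose.mulVec v with hw
      have hvw : v = U.mulVec w := by rw [hw, Matrix.mulVec_mulVec, h1, Matrix.one_mulVec]
      have hDw : (Matrix.diagonal d).mulVec w = t • w := by
        calc (Matrix.diagonal d).mulVec w
            = (U.transpose * U * Matrix.diagonal d).mulVec (U.transpose.mulVec v) := by
              rw [h2, Matrix.one_mul]
          _ = U.transpose.mulVec (A.mulVec v) := by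
              rw [hAe]; simp only [Matrix.mulVec_mulVec, Matrix.mul_assoc]
          _ = t • w := by rw [hAv, Matrix.mulVec_smul]
      have hw0 : w ≠ 0 := by
        intro h0; apply hv; rw [hvw, h0, Matrix.mulVec_zero]
      obtain ⟨i, hi⟩ := Function.ne_iff.1 hw0
      refine ⟨i, ?_⟩
      have := congrFun hDw i
      rw [Matrix.mulVec_diagonal, Pi.smul_apply, smul_eq_mul] at this
      exact mul_right_cancel₀ hi this
    · rintro ⟨i, rfl⟩
      refine ⟨U.mulVec (Pi.single i 1), ?_, ?_⟩
      · intro h0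
        have h3 : U.transpose.mulVec (U.mulVec (Pi.single i 1)) = 0 := by
          rw [h0, Matrix.mulVec_zero]
        rw [Matrix.mulVec_mulVec, h2, Matrix.one_mulVec] at h3
        have := congrFun h3 i
        simp at this
      · rw [hAe, Matrix.mulVec_mulVec, Matrix.mul_assoc, h2, Matrix.mul_one,
          ← Matrix.mulVec_mulVec, ← Matrix.mulVec_smul]
        congr 1
        ext j
        rw [Matrix.mulVec_diagonal]
        by_cases hj : j = i
        · subst hj; simp
        · simp [hj]
  have hne : (Set.range d).Nonempty := ⟨d ⟨0, hn⟩, ⟨_, rfl⟩⟩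
  have hfin : (Set.range d).Finite := Set.finite_range d
  have hl : lam1 A = sSup (Set.range d) := by rw [lam1, hS]
  constructor
  · have := hne.csSup_mem hfin
    rw [← hl, ← hS] at this
    exact this
  · intro w
    have hle : ∀ i, d i ≤ lam1 A := fun i => by
      rw [hl]; exact le_csSup hfin.bddAbove ⟨i, rfl⟩
    set y := U.transpose.mulVec w with hy
    have e1 : w ⬝ᵥ A.mulVec w = ∑ i, d i * (y i * y i) := by
      rw [hAe, Matrix.mul_assoc, ← Matrix.mulVec_mulVec, Matrix.dotProduct_mulVec,
        ← Matrix.mulVec_transpose, ← Matrix.mulVec_mulVec, ← hy, dotProduct]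
      refine Finset.sum_congr rfl fun i _ => ?_
      rw [Matrix.mulVec_diagonal]; ring
    have e2 : w ⬝ᵥ w = ∑ i, y i * y i := by
      have : w ⬝ᵥ w = y ⬝ᵥ y := by
        rw [hy, Matrix.dotProduct_mulVec, ← Matrix.mulVec_transpose, Matrix.transpose_transpose,
          Matrix.mulVec_mulVec, h1, Matrix.one_mulVec]
      rw [this]; rfl
    rw [e1, e2, Finset.mul_sum]
    exact Finset.sum_le_sum fun i _ =>
      mul_le_mul_of_nonneg_right (hle i) (mul_self_nonneg _)

lemma abs_dot_mulVec_le {n : ℕ} (A : Mat n) (v : Fin n → ℝ) :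
    |v ⬝ᵥ A.mulVec v| ≤ ‖A‖ * (v ⬝ᵥ v) := by
  have h1 := dot_le v (A.mulVec v)
  have h2 := mulVec_dot_le A v
  have h3 := dot_self_nonneg v
  refine abs_le_of_sq_le_sq ?_ (by positivity)
  nlinarith

lemma dot_self_pos {n : ℕ} {v : Fin n → ℝ} (hv : v ≠ 0) : 0 < v ⬝ᵥ v := by
  rcases (dot_self_nonneg v).lt_or_eq with h | h
  · exact h
  · exact absurd (dotProduct_self_eq_zero.1 h.symm) hv

lemma lam1_lip {n : ℕ} (hn : 0 < n) {A B : Mat n} (hA : A.IsSymm) (hB : B.IsSymm) :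
    lam1 A - lam1 B ≤ ‖A - B‖ := by
  obtain ⟨⟨v, hv, hAv⟩, -⟩ := lam1_spec hn hA
  have h2 := (lam1_spec hn hB).2 v
  have h3 := abs_dot_mulVec_le (A - B) v
  have h4 := le_of_abs_le h3
  rw [Matrix.sub_mulVec, dotProduct_sub, hAv, dotProduct_smul, smul_eq_mul] at h4
  have h5 := dot_self_pos hv
  have : (lam1 A - lam1 B) * (v ⬝ᵥ v) ≤ ‖A - B‖ * (v ⬝ᵥ v) := by linarith
  exact le_of_mul_le_mul_right this h5

lemma lam1_symm_cont {n : ℕ} : Continuous (fun A : Mat n => lam1 ((1 / 2 : ℝ) • (A + A.transpose))) := by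
  rcases Nat.eq_zero_or_pos n with rfl | hn
  · exact continuous_of_const fun A B => by rw [Subsingleton.elim A B]
  have hs : ∀ A : Mat n, ((1 / 2 : ℝ) • (A + A.transpose)).IsSymm := by
    intro A
    rw [Matrix.IsSymm, Matrix.transpose_smul, Matrix.transpose_add, Matrix.transpose_transpose,
      add_comm]
  have ht : ∀ A : Mat n, ‖A.transpose‖ = ‖A‖ := by
    intro A
    rw [← Matrix.conjTranspose_eq_transpose_of_trivial]
    exact Matrix.l2_opNorm_conjTranspose A
  have hk : ∀ A B : Mat n, lam1 ((1 / 2 : ℝ) • (A + A.transpose))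
      - lam1 ((1 / 2 : ℝ) • (B + B.transpose)) ≤ ‖A - B‖ := by
    intro A B
    refine (lam1_lip hn (hs A) (hs B)).trans ?_
    have : (1 / 2 : ℝ) • (A + A.transpose) - (1 / 2 : ℝ) • (B + B.transpose)
        = (1 / 2 : ℝ) • ((A - B) + (A - B).transpose) := by
      rw [Matrix.transpose_sub, ← smul_sub]; congr 1; abel
    rw [this, norm_smul]
    have h1 := norm_add_le (A - B) (A - B).transpose
    rw [ht] at h1
    rw [Real.norm_of_nonneg (by norm_num)]
    linarith
  have : LipschitzWith 1 (fun A : Mat n => lam1 ((1 / 2 : ℝ) • (A + A.transpose))) := by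
    refine LipschitzWith.of_dist_le_mul fun A B => ?_
    rw [NNReal.coe_one, one_mul, Real.dist_eq, dist_eq_norm, abs_le]
    have h1 := hk A B
    have h2 := hk B A
    rw [norm_sub_rev] at h2
    constructor <;> linarith
  exact this.continuous

set_option maxHeartbeats 2000000 in
lemma real_expand {z lam K a1 a2 a3 q1 q2 q3 q4 : ℝ} (hl : 0 < lam) (hK0 : 0 ≤ K) (hK : K ≤ lam / 8)
    (h1 : z = q1 + lam) (h2 : z * q1 = q2 + lam * a1) (h3 : z * q2 = q3 + lam * a2)
    (h4 : z * q3 = q4 + lam * a3) (hr : |z - lam| ≤ K) (hq2 : |q2| ≤ 2 * K ^ 2)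
    (hq4 : |q4| ≤ 2 * K ^ 4) :
    |z - lam - 1 / lam - a1| ≤ 2 * K / lam * |a1| + 2 / lam * |a2 - 1|
      + 3 * (2 * |a1| + 3 * K ^ 2 / lam) / lam ^ 2 + 2 / lam ^ 2 * |a3| + 3 * K ^ 4 / lam ^ 3 := by
  have hz1 := (abs_le.1 hr).1
  have hz2 := (abs_le.1 hr).2
  have hz : 0 < z := by linarith
  set t := 1 / z with ht
  set l := 1 / lam with hll
  have hl0 : 0 < l := by positivity
  have ht0 : 0 < t := by positivity
  have htl : t ≤ 8 / 7 * l := by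
    rw [ht, hll]
    rw [div_le_iff₀ hz]
    have : 8 / 7 * (1 / lam) * z = (8 / 7 * z) / lam := by ring
    rw [this, le_div_iff₀ hl]; linarith
  have hzt : z * t = 1 := by rw [ht]; field_simp
  have hll1 : lam * l = 1 := by rw [hll]; field_simp
  have t2 : t ^ 2 ≤ (8 / 7 * l) ^ 2 := pow_le_pow_left₀ ht0.le htl 2
  have t3 : t ^ 3 ≤ (8 / 7 * l) ^ 3 := pow_le_pow_left₀ ht0.le htl 3
  have hr' : |z - lam| ≤ 2 * |a1| + 3 * K ^ 2 * l := by
    have : z - lam = (lam * t) * a1 + t * q2 := by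
      have : z - lam = q1 := by linarith
      rw [this]
      calc q1 = (z * t) * q1 := by rw [hzt, one_mul]
        _ = t * (z * q1) := by ring
        _ = _ := by rw [h2]; ring
    rw [this]
    calc _ ≤ |lam * t * a1| + |t * q2| := abs_add_le _ _
      _ = lam * t * |a1| + t * |q2| := by
        rw [abs_mul, abs_mul t, abs_of_pos ht0, abs_of_pos (mul_pos hl ht0)]
      _ ≤ 2 * |a1| + (8 / 7 * l) * (2 * K ^ 2) := by
        have : lam * t ≤ 2 := by nlinarith
        gcongr
      _ ≤ _ := by nlinarith [mul_nonneg hl0.le (sq_nonneg K)]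
  have key : z - lam - l - a1 = (lam - z) * t * a1 + (lam * t ^ 2) * (a2 - 1)
      + (lam - z) * ((lam + z) * l * t ^ 2) + (lam * t ^ 3) * a3 + t ^ 3 * q4 := by
    have e1 : z - lam = q1 := by linarith
    have e2 : q1 = t * q2 + t * lam * a1 := by
      calc q1 = (z * t) * q1 := by rw [hzt, one_mul]
        _ = t * (z * q1) := by ring
        _ = _ := by rw [h2]; ring
    have e3 : q2 = t * q3 + t * lam * a2 := by
      calc q2 = (z * t) * q2 := by rw [hzt, one_mul]
        _ = t * (z * q2) := by ring
        _ = _ := by rw [h3]; ring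
    have e4 : q3 = t * q4 + t * lam * a3 := by
      calc q3 = (z * t) * q3 := by rw [hzt, one_mul]
        _ = t * (z * q3) := by ring
        _ = _ := by rw [h4]; ring
    have e5 : z - lam = t * (t * (t * q4 + t * lam * a3) + t * lam * a2) + t * lam * a1 := by
      rw [← e4, ← e3, ← e2, e1]
    rw [e5]
    have e6 : (lam - z) * ((lam + z) * l * t ^ 2) = (lam * l) * lam * t ^ 2 - (z * t) ^ 2 * l := by
      ring
    rw [e6, hzt, hll1]
    have e7 : (lam - z) * t * a1 = lam * t * a1 - (z * t) * a1 := by ring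
    rw [e7, hzt]
    ring
  have hgoal : 2 * K / lam * |a1| + 2 / lam * |a2 - 1|
      + 3 * (2 * |a1| + 3 * K ^ 2 / lam) / lam ^ 2 + 2 / lam ^ 2 * |a3| + 3 * K ^ 4 / lam ^ 3
      = 2 * K * l * |a1| + 2 * l * |a2 - 1| + 3 * (2 * |a1| + 3 * K ^ 2 * l) * l ^ 2
        + 2 * l ^ 2 * |a3| + 3 * K ^ 4 * l ^ 3 := by
    rw [hll]; field_simp
  rw [hgoal, key]
  have b1 : |(lam - z) * t * a1| ≤ 2 * K * l * |a1| := by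
    rw [abs_mul, abs_mul, abs_sub_comm, abs_of_pos ht0]
    have : |z - lam| * t ≤ 2 * K * l := by
      calc |z - lam| * t ≤ K * (8 / 7 * l) := by gcongr
        _ ≤ _ := by nlinarith [mul_nonneg hK0 hl0.le]
    gcongr
  have ht2 : lam * t ^ 2 ≤ 2 * l := by
    calc lam * t ^ 2 ≤ lam * (8 / 7 * l) ^ 2 := by gcongr
      _ = (64 / 49) * (lam * l) * l := by ring
      _ ≤ 2 * l := by rw [hll1]; linarith
  have ht3 : lam * t ^ 3 ≤ 2 * l ^ 2 := by
    calc lam * t ^ 3 ≤ lam * (8 / 7 * l) ^ 3 := by gcongr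
      _ = (512 / 343) * (lam * l) * l ^ 2 := by ring
      _ ≤ 2 * l ^ 2 := by rw [hll1]; nlinarith [sq_nonneg l]
  have b2 : |(lam * t ^ 2) * (a2 - 1)| ≤ 2 * l * |a2 - 1| := by
    rw [abs_mul, abs_of_pos (by positivity : 0 < lam * t ^ 2)]
    gcongr
  have b3 : |(lam - z) * ((lam + z) * l * t ^ 2)| ≤ 3 * (2 * |a1| + 3 * K ^ 2 * l) * l ^ 2 := by
    rw [abs_mul, abs_sub_comm, abs_of_pos (by positivity : 0 < (lam + z) * l * t ^ 2)]
    have : (lam + z) * l * t ^ 2 ≤ 3 * l ^ 2 := by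
      calc (lam + z) * l * t ^ 2 ≤ (17 / 8 * lam) * l * (8 / 7 * l) ^ 2 := by
            gcongr; linarith
        _ = (17 / 8 * (64 / 49)) * (lam * l) * l ^ 2 := by ring
        _ ≤ 3 * l ^ 2 := by rw [hll1]; nlinarith [sq_nonneg l]
    calc |z - lam| * ((lam + z) * l * t ^ 2) ≤ (2 * |a1| + 3 * K ^ 2 * l) * (3 * l ^ 2) := by gcongr
      _ = _ := by ring
  have b4 : |(lam * t ^ 3) * a3| ≤ 2 * l ^ 2 * |a3| := by
    rw [abs_mul, abs_of_pos (by positivity : 0 < lam * t ^ 3)]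
    gcongr
  have b5 : |t ^ 3 * q4| ≤ 3 * K ^ 4 * l ^ 3 := by
    rw [abs_mul, abs_of_pos (by positivity : 0 < t ^ 3)]
    calc t ^ 3 * |q4| ≤ (8 / 7 * l) ^ 3 * (2 * K ^ 4) := by gcongr
      _ = (1024 / 343) * (K ^ 4 * l ^ 3) := by ring
      _ ≤ _ := by nlinarith [show 0 ≤ K ^ 4 * l ^ 3 by positivity]
  refine (abs_add_le _ _).trans (add_le_add ((abs_add_le _ _).trans (add_le_add
    ((abs_add_le _ _).trans (add_le_add ((abs_add_le _ _).trans (add_le_add b1 b2)) b3)) b4)) b5)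

lemma lam1_expand {n : ℕ} (hn : 0 < n) {W : Mat n} (hW : W.IsSymm) {u : Fin n → ℝ}
    (hu : u ⬝ᵥ u = 1) {lam K : ℝ} (hl : 0 < lam) (hWK : ‖W‖ ≤ K) (hK : K ≤ lam / 8) :
    |lam1 (W + lam • Matrix.vecMulVec u u) - lam - 1 / lam - u ⬝ᵥ W.mulVec u|
      ≤ 2 * K / lam * |u ⬝ᵥ W.mulVec u| + 2 / lam * |u ⬝ᵥ (W * W).mulVec u - 1|
      + 3 * (2 * |u ⬝ᵥ W.mulVec u| + 3 * K ^ 2 / lam) / lam ^ 2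
      + 2 / lam ^ 2 * |u ⬝ᵥ (W * W * W).mulVec u| + 3 * K ^ 4 / lam ^ 3 := by
  have hK0 : 0 ≤ K := (norm_nonneg _).trans hWK
  set M := W + lam • Matrix.vecMulVec u u with hM
  have hMs : M.IsSymm := by
    rw [Matrix.IsSymm, hM, Matrix.transpose_add, Matrix.transpose_smul, hW.eq,
      Matrix.transpose_vecMulVec]
  have hMv : ∀ v, M.mulVec v = W.mulVec v + (lam * (u ⬝ᵥ v)) • u := by
    intro v
    rw [hM, Matrix.add_mulVec, Matrix.smul_mulVec, Matrix.vecMulVec_mulVec]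
    congr 1
    ext i
    simp only [Pi.smul_apply, smul_eq_mul, MulOpposite.smul_eq_mul_unop, MulOpposite.unop_op]
    ring
  obtain ⟨⟨v, hv, hvM⟩, hray⟩ := lam1_spec hn hMs
  set z := lam1 M with hz
  rw [hMv] at hvM
  set s := u ⬝ᵥ v with hs
  have hvv := dot_self_pos hv
  have hWb : ∀ w : Fin n → ℝ, |w ⬝ᵥ W.mulVec w| ≤ K * (w ⬝ᵥ w) := fun w =>
    (abs_dot_mulVec_le W w).trans (mul_le_mul_of_nonneg_right hWK (dot_self_nonneg w))
  have hzlo : lam - K ≤ z := by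
    have h1 := hray u
    rw [hMv, dotProduct_add, dotProduct_smul, hu, smul_eq_mul] at h1
    have h2 := neg_le_of_abs_le (hWb u)
    rw [hu] at h2
    linarith
  have hss : s ^ 2 ≤ v ⬝ᵥ v := by
    have := dot_le u v
    rwa [hu, one_mul] at this
  have hzv : z * (v ⬝ᵥ v) = v ⬝ᵥ W.mulVec v + lam * s ^ 2 := by
    have := congrArg (fun y => v ⬝ᵥ y) hvM
    simp only [dotProduct_add, dotProduct_smul, smul_eq_mul] at this
    rw [dotProduct_comm v u, ← hs] at this
    linarith
  have hvW := le_of_abs_le (hWb v)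
  have hzhi : z ≤ lam + K := by
    have : z * (v ⬝ᵥ v) ≤ (lam + K) * (v ⬝ᵥ v) := by nlinarith
    exact le_of_mul_le_mul_right this hvv
  have hvs : v ⬝ᵥ v ≤ 4 * s ^ 2 := by
    have h1 : (z - K) * (v ⬝ᵥ v) ≤ lam * s ^ 2 := by linarith
    have h2 : lam / 4 * (v ⬝ᵥ v) ≤ (z - K) * (v ⬝ᵥ v) := by
      apply mul_le_mul_of_nonneg_right _ hvv.le
      linarith
    have h3 : lam * (v ⬝ᵥ v) ≤ lam * (4 * s ^ 2) := by linarith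
    exact le_of_mul_le_mul_left h3 hl
  have hs0 : s ≠ 0 := by
    rintro h0
    rw [h0] at hvs
    linarith
  have hp : ∀ P : Mat n, z * (u ⬝ᵥ P.mulVec v) = u ⬝ᵥ (P * W).mulVec v
      + lam * s * (u ⬝ᵥ P.mulVec u) := by
    intro P
    have := congrArg (fun y => u ⬝ᵥ P.mulVec y) hvM
    simp only [Matrix.mulVec_add, Matrix.mulVec_smul, dotProduct_add, dotProduct_smul, smul_eq_mul,
      Matrix.mulVec_mulVec] at this
    linarith
  have hq : ∀ P : Mat n, z * ((u ⬝ᵥ P.mulVec v) / s) = (u ⬝ᵥ (P * W).mulVec v) / s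
      + lam * (u ⬝ᵥ P.mulVec u) := by
    intro P
    rw [← mul_div_assoc, hp P]
    field_simp
  have hqb : ∀ (P : Mat n) (B : ℝ), 0 ≤ B → ‖P‖ ≤ B → |(u ⬝ᵥ P.mulVec v) / s| ≤ 2 * B := by
    intro P B hB hPB
    rw [abs_div, div_le_iff₀ (abs_pos.2 hs0)]
    have h1 := dot_le u (P.mulVec v)
    rw [hu, one_mul] at h1
    have h2 := mulVec_dot_le P v
    have h3 : ‖P‖ ^ 2 ≤ B ^ 2 := pow_le_pow_left₀ (norm_nonneg _) hPB 2
    refine abs_le_of_sq_le_sq ?_ (by positivity)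
    calc _ ≤ ‖P‖ ^ 2 * (v ⬝ᵥ v) := h1.trans h2
      _ ≤ B ^ 2 * (4 * s ^ 2) := by gcongr
      _ = (2 * B * |s|) ^ 2 := by rw [mul_pow, mul_pow, sq_abs]; ring
  have hn2 : ‖W * W‖ ≤ K ^ 2 := by
    rw [pow_two]; exact (norm_mul_le _ _).trans (by gcongr)
  have hn4 : ‖W * W * W * W‖ ≤ K ^ 4 := by
    calc ‖W * W * W * W‖ ≤ ‖W‖ * ‖W‖ * ‖W‖ * ‖W‖ := by
          refine (norm_mul_le _ _).trans ?_
          gcongr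
          refine (norm_mul_le _ _).trans ?_
          gcongr
          exact norm_mul_le _ _
      _ ≤ K * K * K * K := by gcongr
      _ = K ^ 4 := by ring
  refine real_expand (q1 := (u ⬝ᵥ W.mulVec v) / s) (q2 := (u ⬝ᵥ (W * W).mulVec v) / s)
    (q3 := (u ⬝ᵥ (W * W * W).mulVec v) / s) (q4 := (u ⬝ᵥ (W * W * W * W).mulVec v) / s)
    hl hK0 hK ?_ (hq W) (hq (W * W)) (hq (W * W * W)) ?_ (hqb _ _ (by positivity) hn2)
    (hqb _ _ (by positivity) hn4)
  · have := hq 1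
    simp only [Matrix.one_mulVec, one_mul, ← hs, div_self hs0, hu, mul_one] at this
    exact this
  · rw [abs_le]; constructor <;> linarith
end det
section law
open scoped Matrix.Norms.L2Operator
attribute [local instance] matMS matBorel

variable {Ω : Type*} [MeasureSpace Ω] [IsProbabilityMeasure (volume : Measure Ω)]

lemma gv_memLp {ι : Type*} [Fintype ι] [DecidableEq ι] {X : ι → Ω → ℝ}
    (h : IsCenteredGaussianVec X) (i : ι) : MemLp (X i) 2 (volume : Measure Ω) := by
  obtain ⟨v, hv⟩ := h.2 (Pi.single i 1)
  have : (fun ω => ∑ j, (Pi.single i (1:ℝ) : ι → ℝ) j * X j ω) = X i := by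
    ext ω
    rw [Finset.sum_eq_single i] <;> simp +contextual [Pi.single_apply]
  rw [this] at hv
  have h2 : MemLp id 2 (gaussianReal 0 v) := memLp_id_gaussianReal 2
  rw [← hv, memLp_map_measure_iff (by fun_prop) (h.1 i).aemeasurable] at h2
  exact h2

lemma sum_abs_sq_le {n : ℕ} (b : Fin n → ℝ) : (∑ i, |b i|) ^ 2 ≤ n * (b ⬝ᵥ b) := by
  have := sq_sum_le_card_mul_sum_sq (s := Finset.univ) (f := fun i => |b i|)
  simp only [sq_abs, Finset.card_univ, Fintype.card_fin] at this
  refine this.trans (le_of_eq ?_)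
  simp only [dotProduct, pow_two]

lemma mat_meas {n : ℕ} {X : Ω → Mat n} (h : ∀ i j, Measurable fun ω => X ω i j) :
    Measurable X := by
  have : X = fun ω => ∑ i, ∑ j, X ω i j • Matrix.single i j (1:ℝ) := by
    ext1 ω
    conv_lhs => rw [Matrix.matrix_eq_sum_single (X ω)]
    simp
  rw [this]
  refine Finset.measurable_sum _ fun i _ => Finset.measurable_sum _ fun j _ => ?_
  have hc : Continuous fun t : ℝ => t • (Matrix.single i j (1:ℝ) : Mat n) := by fun_prop
  exact hc.measurable.comp (h i j)

lemma sq_sum_sum {n : ℕ} (f : Fin n → Fin n → ℝ) :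
    (∑ i, ∑ j, f i j) ^ 2 = ∑ i, ∑ j, ∑ k, ∑ l, f i j * f k l := by
  rw [pow_two, Finset.sum_mul]
  refine Finset.sum_congr rfl fun i _ => ?_
  rw [Finset.sum_mul]
  refine Finset.sum_congr rfl fun j _ => ?_
  rw [Finset.mul_sum]
  refine Finset.sum_congr rfl fun k _ => ?_
  rw [Finset.mul_sum]

lemma quad_moment {n : ℕ} {M : Fin n → Fin n → Fin n → Fin n → ℝ} {η : ℝ} (hη : 0 ≤ η)
    (hM : ∀ i j k l, |M i j k l| ≤ (if i = k then 1 else 0) * (if j = l then 1 else 0)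
      + (if i = l then 1 else 0) * (if j = k then 1 else 0) + η) (a b : Fin n → ℝ) :
    ∑ i, ∑ j, ∑ k, ∑ l, (a i * b j) * (a k * b l) * M i j k l
      ≤ (2 + n ^ 2 * η) * ((a ⬝ᵥ a) * (b ⬝ᵥ b)) := by
  have h1 : ∑ i, ∑ j, ∑ k, ∑ l, (a i * b j) * (a k * b l) * M i j k l
      ≤ ∑ i, ∑ j, ∑ k, ∑ l, (|a i| * |b j|) * (|a k| * |b l|) *
        ((if i = k then 1 else 0) * (if j = l then 1 else 0)
      + (if i = l then 1 else 0) * (if j = k then 1 else 0) + η) := by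
    refine Finset.sum_le_sum fun i _ => Finset.sum_le_sum fun j _ => Finset.sum_le_sum fun k _ =>
      Finset.sum_le_sum fun l _ => ?_
    refine (le_abs_self _).trans ?_
    rw [abs_mul, abs_mul, abs_mul, abs_mul]
    exact mul_le_mul_of_nonneg_left (hM i j k l) (by positivity)
  refine h1.trans ?_
  have h2 : ∑ i, ∑ j, ∑ k, ∑ l, (|a i| * |b j|) * (|a k| * |b l|) *
        ((if i = k then (1:ℝ) else 0) * (if j = l then 1 else 0)
      + (if i = l then 1 else 0) * (if j = k then 1 else 0) + η)
      = (a ⬝ᵥ a) * (b ⬝ᵥ b) + (∑ i, |a i| * |b i|) ^ 2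
        + η * ((∑ i, |a i|) ^ 2 * (∑ i, |b i|) ^ 2) := by
    simp only [mul_add, Finset.sum_add_distrib]
    congr 1
    · congr 1
      · simp only [mul_ite, ite_mul, mul_zero, zero_mul, mul_one, one_mul, Finset.sum_ite_eq,
          Finset.mem_univ, if_true, dotProduct, Finset.sum_mul_sum]
        refine Finset.sum_congr rfl fun i _ => Finset.sum_congr rfl fun j _ => ?_
        rw [← abs_mul_abs_self (a i), ← abs_mul_abs_self (b j)]; ring
      · have : ∀ i j k l : Fin n, (|a i| * |b j|) * (|a k| * |b l|) *
          ((if i = l then (1:ℝ) else 0) * (if j = k then 1 else 0))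
          = if i = l then (if j = k then (|a i| * |b j|) * (|a k| * |b l|) else 0) else 0 := by
          intro i j k l; split_ifs <;> simp
        simp only [this, Finset.sum_ite_eq, Finset.mem_univ, if_true, pow_two, Finset.sum_mul_sum]
        refine Finset.sum_congr rfl fun i _ => Finset.sum_congr rfl fun j _ => ?_
        ring
    · rw [← mul_pow, Finset.sum_mul_sum, sq_sum_sum]
      simp only [Finset.mul_sum]
      refine Finset.sum_congr rfl fun i _ => Finset.sum_congr rfl fun j _ =>
        Finset.sum_congr rfl fun k _ => Finset.sum_congr rfl fun l _ => ?_
      ring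
  rw [h2]
  have h3 : (∑ i, |a i| * |b i|) ^ 2 ≤ (a ⬝ᵥ a) * (b ⬝ᵥ b) := by
    have := dot_le (fun i => |a i|) (fun i => |b i|)
    simpa [dotProduct, abs_mul_abs_self] using this
  have h4 := sum_abs_sq_le a
  have h5 := sum_abs_sq_le b
  have h6 : (∑ i, |a i|) ^ 2 * (∑ i, |b i|) ^ 2 ≤ (n * (a ⬝ᵥ a)) * (n * (b ⬝ᵥ b)) := by
    have := dot_self_nonneg a
    gcongr
  have h7 := mul_le_mul_of_nonneg_left h6 hη
  nlinarith

lemma diag_moment {n : ℕ} {M : Fin n → Fin n → Fin n → ℝ} {η : ℝ} (hη : 0 ≤ η)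
    (hM : ∀ i j l, |M i j l - (if j = l then 1 else 0)| ≤ η) (b : Fin n → ℝ) :
    |∑ i, ∑ j, ∑ l, (b j * b l) * M i j l - n * (b ⬝ᵥ b)| ≤ n ^ 2 * η * (b ⬝ᵥ b) := by
  have e : (n : ℝ) * (b ⬝ᵥ b) = ∑ i : Fin n, ∑ j, ∑ l, (b j * b l) * (if j = l then 1 else 0) := by
    simp [dotProduct]
  rw [e]
  simp only [← Finset.sum_sub_distrib, ← mul_sub]
  have : ∀ i : Fin n, |∑ j, ∑ l, (b j * b l) * (M i j l - (if j = l then 1 else 0))|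
      ≤ η * (n * (b ⬝ᵥ b)) := by
    intro i
    refine (Finset.abs_sum_le_sum_abs _ _).trans ?_
    calc _ ≤ ∑ j, ∑ l, |b j| * |b l| * η := by
          refine Finset.sum_le_sum fun j _ => (Finset.abs_sum_le_sum_abs _ _).trans
            (Finset.sum_le_sum fun l _ => ?_)
          rw [abs_mul, abs_mul]
          exact mul_le_mul_of_nonneg_left (hM i j l) (by positivity)
      _ = η * (∑ j, |b j|) ^ 2 := by
          rw [pow_two, Finset.sum_mul_sum, Finset.mul_sum]
          refine Finset.sum_congr rfl fun j _ => ?_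
          rw [Finset.mul_sum]
          exact Finset.sum_congr rfl fun l _ => by ring
      _ ≤ _ := mul_le_mul_of_nonneg_left (sum_abs_sq_le b) hη
  refine (Finset.abs_sum_le_sum_abs _ _).trans ((Finset.sum_le_sum fun i _ => this i).trans ?_)
  rw [Finset.sum_const, Finset.card_univ, Fintype.card_fin, nsmul_eq_mul]
  apply le_of_eq; ring

/-- The law of `n^{-1/2} X`. -/
lemma law_GM {n : ℕ} (hn : 0 < n) {X : Ω → Mat n} {η r : ℝ} (hη : 0 ≤ η) (hr : r ^ 2 = 1 / n)
    (hs : ∀ ω, (X ω).IsSymm)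
    (hg : IsCenteredGaussianVec fun p : Fin n × Fin n => fun ω => X ω p.1 p.2)
    (hv : ∀ i j : Fin n, ∫ ω, (X ω i j) ^ 2 = 1)
    (hcorr : ∀ i j i' j' : Fin n, ¬((i, j) = (i', j') ∨ (i, j) = (j', i')) →
      |∫ ω, X ω i j * X ω i' j'| ≤ η) :
    Measurable (fun ω => r • X ω) ∧
    GM (Measure.map (fun ω => r • X ω) volume) (1 + n * η) (2 / n + n * η) ∧
    ∀ b : Fin n → ℝ, |∫ x, (x.mulVec b) ⬝ᵥ (x.mulVec b) ∂(Measure.map (fun ω => r • X ω) volume)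
      - b ⬝ᵥ b| ≤ n * η * (b ⬝ᵥ b) := by
  have hn' : (0:ℝ) < n := by exact_mod_cast hn
  have hmX : ∀ i j, Measurable fun ω => X ω i j := fun i j => hg.1 (i, j)
  have hm : Measurable (fun ω => r • X ω) := by
    refine mat_meas fun i j => ?_
    simpa using (hmX i j).const_mul r
  have hL2 : ∀ i j, MemLp (fun ω => X ω i j) 2 (volume : Measure Ω) := fun i j => gv_memLp hg (i, j)
  have hIntg : ∀ i j k l, Integrable (fun ω => X ω i j * X ω k l) := fun i j k l =>
    (hL2 i j).integrable_mul (hL2 k l)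
  set M : Fin n → Fin n → Fin n → Fin n → ℝ := fun i j k l => ∫ ω, X ω i j * X ω k l with hMd
  have hM1 : ∀ i j k l, ((i, j) = (k, l) ∨ (i, j) = (l, k)) → M i j k l = 1 := by
    intro i j k l h
    rw [← hv i j]
    refine integral_congr_ae (ae_of_all _ fun ω => ?_)
    rcases h with h | h
    · obtain ⟨rfl, rfl⟩ := Prod.mk.inj h
      simp only [pow_two]
    · obtain ⟨rfl, rfl⟩ := Prod.mk.inj h
      simp only [pow_two]
      rw [(hs ω).apply]
  have hMq : ∀ i j k l, |M i j k l| ≤ (if i = k then 1 else 0) * (if j = l then 1 else 0)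
      + (if i = l then 1 else 0) * (if j = k then 1 else 0) + η := by
    intro i j k l
    by_cases h : (i, j) = (k, l) ∨ (i, j) = (l, k)
    · rw [hM1 i j k l h, abs_one]
      rcases h with h | h
      · obtain ⟨rfl, rfl⟩ := Prod.mk.inj h
        have : (0:ℝ) ≤ (if i = j then 1 else 0) * (if j = i then 1 else 0) := by
          split_ifs <;> simp
        simp only [if_true]; linarith
      · obtain ⟨rfl, rfl⟩ := Prod.mk.inj h
        have : (0:ℝ) ≤ (if i = j then 1 else 0) * (if j = i then 1 else 0) := by
          split_ifs <;> simp
        simp only [if_true]; linarith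
    · refine (hcorr i j k l h).trans ?_
      have h1 : (0:ℝ) ≤ (if i = k then 1 else 0) * (if j = l then 1 else 0) := by
          split_ifs <;> simp
      have h2 : (0:ℝ) ≤ (if i = l then 1 else 0) * (if j = k then 1 else 0) := by
          split_ifs <;> simp
      linarith
  have hMd' : ∀ i j l, |M i j i l - (if j = l then 1 else 0)| ≤ η := by
    intro i j l
    by_cases h : j = l
    · rw [if_pos h, hM1 i j i l (Or.inl (by rw [h]))]; simpa using hη
    · rw [if_neg h, sub_zero]
      refine hcorr i j i l ?_
      rintro (h' | h')
      · exact h (Prod.mk.inj h').2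
      · exact h ((Prod.mk.inj h').2.trans (Prod.mk.inj h').1)
  have hsec : ∀ b : Fin n → ℝ,
      |∫ x, (x.mulVec b) ⬝ᵥ (x.mulVec b) ∂(Measure.map (fun ω => r • X ω) volume)
      - b ⬝ᵥ b| ≤ n * η * (b ⬝ᵥ b) := by
    intro b
    rw [integral_map hm.aemeasurable (PG.dotmv b).1.aestronglyMeasurable]
    have e1 : ∀ ω, ((r • X ω).mulVec b) ⬝ᵥ ((r • X ω).mulVec b)
        = r ^ 2 * ∑ i, ∑ j, ∑ l, (b j * b l) * (X ω i j * X ω i l) := by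
      intro ω
      rw [Matrix.smul_mulVec, smul_dotProduct, dotProduct_smul, smul_eq_mul, smul_eq_mul,
        ← mul_assoc, ← pow_two]
      congr 1
      simp only [dotProduct, Matrix.mulVec, Finset.sum_mul_sum]
      refine Finset.sum_congr rfl fun i _ => Finset.sum_congr rfl fun j _ =>
        Finset.sum_congr rfl fun l _ => ?_
      ring
    simp_rw [e1]
    rw [integral_const_mul]
    have e2 : ∫ ω, ∑ i, ∑ j, ∑ l, (b j * b l) * (X ω i j * X ω i l)
        = ∑ i, ∑ j, ∑ l, (b j * b l) * M i j i l := by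
      rw [integral_finsetSum _ fun i _ => integrable_finsetSum _ fun j _ =>
        integrable_finsetSum _ fun l _ => (hIntg i j i l).const_mul _]
      refine Finset.sum_congr rfl fun i _ => ?_
      rw [integral_finsetSum _ fun j _ =>
        integrable_finsetSum _ fun l _ => (hIntg i j i l).const_mul _]
      refine Finset.sum_congr rfl fun j _ => ?_
      rw [integral_finsetSum _ fun l _ => (hIntg i j i l).const_mul _]
      refine Finset.sum_congr rfl fun l _ => ?_
      rw [integral_const_mul]
    rw [e2, hr]
    have := diag_moment hη (M := fun i j l => M i j i l) hMd' b
    set T := ∑ i, ∑ j, ∑ l, (b j * b l) * M i j i l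
    have e3 : 1 / (n:ℝ) * T - b ⬝ᵥ b = (1 / n) * (T - n * (b ⬝ᵥ b)) := by field_simp
    rw [e3, abs_mul, abs_of_pos (by positivity : (0:ℝ) < 1 / n)]
    calc _ ≤ 1 / (n:ℝ) * (n ^ 2 * η * (b ⬝ᵥ b)) := by gcongr
      _ = _ := by field_simp
  have hmapL : ∀ L : Mat n →L[ℝ] ℝ, ∃ v, Measure.map L (Measure.map (fun ω => r • X ω) volume)
      = gaussianReal 0 v := by
    intro L
    obtain ⟨v, hv⟩ := hg.2 (fun p => r * L (Matrix.single p.1 p.2 1))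
    refine ⟨v, ?_⟩
    rw [Measure.map_map L.continuous.measurable hm, ← hv]
    congr 1
    ext ω
    simp only [Function.comp]
    conv_lhs => rw [map_smul, Matrix.matrix_eq_sum_single (X ω)]
    rw [map_sum, Fintype.sum_prod_type, smul_eq_mul, Finset.mul_sum]
    refine Finset.sum_congr rfl fun i _ => ?_
    rw [map_sum, Finset.mul_sum]
    refine Finset.sum_congr rfl fun j _ => ?_
    have : (Matrix.single i j (X ω i j) : Mat n) = X ω i j • Matrix.single i j 1 := by simp
    rw [this, map_smul, smul_eq_mul]
    ring
  have hgauss : IsGaussian (Measure.map (fun ω => r • X ω) volume) :=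
    isGaussian_of_map_eq_gaussianReal fun L => ⟨0, hmapL L⟩
  refine ⟨hm, ⟨hgauss, ?_, ?_, ?_, ?_⟩, hsec⟩
  · have hi : Integrable id (Measure.map (fun ω => r • X ω) volume) :=
      (IsGaussian.memLp_id _ 1 (by simp)).integrable le_rfl
    ext i j
    set L := bilCLM (Pi.single i 1 : Fin n → ℝ) (Pi.single j 1) with hL
    have hLe : ∀ x : Mat n, L x = x i j := fun x => by
      rw [hL, bilCLM_apply]; simp
    have hcc := L.integral_comp_comm hi
    rw [hLe] at hcc
    refine hcc.symm.trans ?_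
    obtain ⟨v, hv⟩ := hmapL L
    have := integral_map (μ := Measure.map (fun ω => r • X ω) volume) (φ := L)
      L.continuous.measurable.aemeasurable (f := fun y : ℝ => y) (by fun_prop)
    rw [hv, integral_id_gaussianReal] at this
    exact this.symm
  · rw [ae_map_iff hm.aemeasurable]
    · refine ae_of_all _ fun ω => ?_
      rw [Matrix.IsSymm, Matrix.transpose_smul, hs ω]
    · have hc : IsClosed {x : Mat n | trspCLM n x = x} :=
        isClosed_eq (trspCLM n).continuous continuous_id
      exact hc.measurableSet
  · intro b
    have := le_of_abs_le (hsec b)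
    linarith
  · intro a b
    have hcont : Continuous fun x : Mat n => (a ⬝ᵥ (x.mulVec b)) ^ 2 :=
      (bilCLM a b).continuous.pow 2
    rw [integral_map hm.aemeasurable hcont.aestronglyMeasurable]
    have e1 : ∀ ω, (a ⬝ᵥ ((r • X ω).mulVec b)) ^ 2
        = r ^ 2 * ∑ i, ∑ j, ∑ k, ∑ l, (a i * b j) * (a k * b l) * (X ω i j * X ω k l) := by
      intro ω
      rw [Matrix.smul_mulVec, dotProduct_smul, smul_eq_mul, mul_pow]
      congr 1
      simp only [dotProduct, Matrix.mulVec, Finset.mul_sum]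
      rw [sq_sum_sum]
      refine Finset.sum_congr rfl fun i _ => Finset.sum_congr rfl fun j _ =>
        Finset.sum_congr rfl fun k _ => Finset.sum_congr rfl fun l _ => ?_
      ring
    simp_rw [e1]
    rw [integral_const_mul]
    have e2 : ∫ ω, ∑ i, ∑ j, ∑ k, ∑ l, (a i * b j) * (a k * b l) * (X ω i j * X ω k l)
        = ∑ i, ∑ j, ∑ k, ∑ l, (a i * b j) * (a k * b l) * M i j k l := by
      rw [integral_finsetSum _ fun i _ => integrable_finsetSum _ fun j _ =>
        integrable_finsetSum _ fun k _ =>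
        integrable_finsetSum _ fun l _ => (hIntg i j k l).const_mul _]
      refine Finset.sum_congr rfl fun i _ => ?_
      rw [integral_finsetSum _ fun j _ => integrable_finsetSum _ fun k _ =>
        integrable_finsetSum _ fun l _ => (hIntg i j k l).const_mul _]
      refine Finset.sum_congr rfl fun j _ => ?_
      rw [integral_finsetSum _ fun k _ =>
        integrable_finsetSum _ fun l _ => (hIntg i j k l).const_mul _]
      refine Finset.sum_congr rfl fun k _ => ?_
      rw [integral_finsetSum _ fun l _ => (hIntg i j k l).const_mul _]
      refine Finset.sum_congr rfl fun l _ => ?_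
      rw [integral_const_mul]
    rw [e2, hr]
    have := quad_moment hη hMq a b
    calc _ ≤ 1 / (n:ℝ) * ((2 + n ^ 2 * η) * ((a ⬝ᵥ a) * (b ⬝ᵥ b))) := by gcongr
      _ = _ := by field_simp
end law
section fin
open scoped Matrix.Norms.L2Operator
attribute [local instance] matMS matBorel

lemma GM.mono {n : ℕ} {μ : Measure (Mat n)} {c κ c' κ' : ℝ} (h : GM μ c κ) (hc : c ≤ c')
    (hκ : κ ≤ κ') : GM μ c' κ' :=
  ⟨h.gauss, h.cent, h.symm,
    fun b => (h.hc b).trans (mul_le_mul_of_nonneg_right hc (dot_self_nonneg b)),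
    fun a b => (h.hκ a b).trans (mul_le_mul_of_nonneg_right hκ
      (mul_nonneg (dot_self_nonneg a) (dot_self_nonneg b)))⟩

lemma abs_int_le {α : Type*} [MeasurableSpace α] {μ : Measure α} [IsProbabilityMeasure μ]
    {f : α → ℝ} {s : ℝ} (hs : 0 < s) (hf : Integrable f μ) (hf2 : Integrable (fun x => f x ^ 2) μ)
    (h : ∫ x, f x ^ 2 ∂μ ≤ s ^ 2) : ∫ x, |f x| ∂μ ≤ s := by
  have h1 : ∫ x, |f x| ∂μ ≤ ∫ x, (s / 2 + 1 / (2 * s) * f x ^ 2) ∂μ := by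
    refine integral_mono hf.abs ((integrable_const _).add (hf2.const_mul _)) fun x => ?_
    have h2 : 0 ≤ (|f x| - s) ^ 2 := sq_nonneg _
    have h3 : s / 2 + 1 / (2 * s) * f x ^ 2 - |f x| = 1 / (2 * s) * (|f x| - s) ^ 2 := by
      rw [← sq_abs (f x)]; field_simp; ring
    have : 0 ≤ 1 / (2 * s) * (|f x| - s) ^ 2 := by positivity
    simp only
    linarith
  refine h1.trans ?_
  rw [integral_add (integrable_const _) (hf2.const_mul _), integral_const_mul]
  simp only [integral_const, probReal_univ, smul_eq_mul, one_mul]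
  have : 1 / (2 * s) * ∫ x, f x ^ 2 ∂μ ≤ 1 / (2 * s) * s ^ 2 := by gcongr
  have h4 : 1 / (2 * s) * s ^ 2 = s / 2 := by field_simp
  linarith

lemma gm_fourth {n : ℕ} {μ : Measure (Mat n)} {c κ : ℝ} (h : GM μ c κ) (hc : 0 ≤ c) (k : ℕ)
    (hn : 0 < n) {K A : ℝ} (hK : 1 ≤ K) (hk : 1 ≤ k) (hnK : (n:ℝ) ≤ K ^ (2 * 2 ^ k - 4))
    (hA : A = ((2 * 2 ^ k + 1) * c) ^ (2 ^ k)) :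
    ∫ x, ‖x‖ ^ 4 ∂μ ≤ (1 + A) * K ^ 4 ∧ μ {x | K < ‖x‖} ≤ ENNReal.ofReal (A / K ^ 4) := by
  have := h.gauss
  have hn' : (0:ℝ) < n := by exact_mod_cast hn
  have hp : 4 ≤ 2 * 2 ^ k := by
    have : 2 ^ 1 ≤ 2 ^ k := Nat.pow_le_pow_right (by norm_num) hk
    omega
  set q := 2 * 2 ^ k - 4 with hq
  have hpq : 2 * 2 ^ k = 4 + q := by omega
  have hA0 : 0 ≤ A := by rw [hA]; positivity
  have hK4 : 1 ≤ K ^ 4 := one_le_pow₀ hK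
  have hbig := gm_norm h hc k
  rw [← hA] at hbig
  have hiN := (PG.nrm (n := n) (2 * 2 ^ k)).integrable μ
  have key : ∀ x : Mat n, K < ‖x‖ → n * ‖x‖ ^ 4 ≤ ‖x‖ ^ (2 * 2 ^ k) := by
    intro x hx
    rw [hpq, pow_add, mul_comm]
    have : K ^ q ≤ ‖x‖ ^ q := pow_le_pow_left₀ (by linarith) hx.le q
    have h2 := hnK.trans this
    gcongr
  constructor
  · have h1 : ∫ x, ‖x‖ ^ 4 ∂μ ≤ ∫ x : Mat n, (K ^ 4 + 1 / n * ‖x‖ ^ (2 * 2 ^ k)) ∂μ := by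
      refine integral_mono ((PG.nrm 4).integrable μ)
        ((integrable_const _).add (hiN.const_mul _)) fun x => ?_
      simp only
      rcases le_or_gt ‖x‖ K with hx | hx
      · have h1 : ‖x‖ ^ 4 ≤ K ^ 4 := pow_le_pow_left₀ (norm_nonneg _) hx 4
        have h2 : 0 ≤ 1 / (n:ℝ) * ‖x‖ ^ (2 * 2 ^ k) := by positivity
        linarith
      · have h1 : 1 / (n:ℝ) * (n * ‖x‖ ^ 4) ≤ 1 / (n:ℝ) * ‖x‖ ^ (2 * 2 ^ k) := by
          gcongr; exact key x hx
        have h2 : 1 / (n:ℝ) * (n * ‖x‖ ^ 4) = ‖x‖ ^ 4 := by field_simp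
        linarith
    refine h1.trans ?_
    rw [integral_add (integrable_const _) (hiN.const_mul _), integral_const_mul]
    simp only [integral_const, probReal_univ, smul_eq_mul, one_mul]
    have h3 : 1 / (n:ℝ) * ∫ x, ‖x‖ ^ (2 * 2 ^ k) ∂μ ≤ 1 / (n:ℝ) * (A * n) := by gcongr
    have h4 : 1 / (n:ℝ) * (A * n) = A := by field_simp
    nlinarith
  · have hsub : {x : Mat n | K < ‖x‖} ⊆ {x | n * K ^ 4 ≤ ‖x‖ ^ (2 * 2 ^ k)} := by
      intro x hx
      refine le_trans ?_ (key x hx)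
      have h1 : K ^ 4 ≤ ‖x‖ ^ 4 := pow_le_pow_left₀ (by linarith) (le_of_lt hx) 4
      gcongr
    refine (measure_mono hsub).trans ?_
    have hmk := mul_meas_ge_le_integral_of_nonneg (μ := μ) (f := fun x : Mat n => ‖x‖ ^ (2 * 2 ^ k))
      (ae_of_all _ fun x => by positivity) hiN (n * K ^ 4)
    rw [← ENNReal.ofReal_toReal (measure_ne_top μ {x | n * K ^ 4 ≤ ‖x‖ ^ (2 * 2 ^ k)})]
    refine ENNReal.ofReal_le_ofReal ?_
    rw [le_div_iff₀ (by positivity)]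
    have h5 : (n * K ^ 4) * (μ {x | n * K ^ 4 ≤ ‖x‖ ^ (2 * 2 ^ k)}).toReal ≤ A * n := hmk.trans hbig
    have h6 : n * ((μ {x | n * K ^ 4 ≤ ‖x‖ ^ (2 * 2 ^ k)}).toReal * K ^ 4) ≤ n * A := by linarith
    exact le_of_mul_le_mul_left h6 hn'

set_option maxHeartbeats 1000000 in
lemma core_bound {n : ℕ} (hn : 0 < n) {μ : Measure (Mat n)} {c κ C K A lam : ℝ} (h : GM μ c κ)
    (hC : 0 ≤ C) (hA0 : 0 ≤ A) (hK : 1 ≤ K) (hκ : κ = (2 + C) / K ^ 32)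
    (h4 : ∫ x, ‖x‖ ^ 4 ∂μ ≤ (1 + A) * K ^ 4) (hP : μ {x | K < ‖x‖} ≤ ENNReal.ofReal (A / K ^ 4))
    {u : Fin n → ℝ} (hu : u ⬝ᵥ u = 1)
    (hmean : |∫ x, bilCLM u u (x * x) ∂μ - 1| ≤ C / K ^ 32)
    (hl8 : 8 * K ≤ lam) (hl : K ^ 8 ≤ lam) {s : ℝ} (hs : 0 < s) :
    μ {x | s ≤ |K ^ 16 * (lam1 (x + lam • Matrix.vecMulVec u u) - lam - 1 / lam
        - u ⬝ᵥ x.mulVec u)|}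
      ≤ ENNReal.ofReal (A / K ^ 4 + 800 * (2 + C) * (2 + A) / K ^ 4 / s) := by
  have hg := h.gauss
  have hK0 : 0 < K := by linarith
  have hlam : 0 < lam := by linarith
  set c' := 36 * (2 + C) * (2 + A) with hc'
  have hc1 : 1 ≤ c' := by nlinarith [mul_nonneg hC hA0]
  have hc2 : c' ≤ c' ^ 2 := by nlinarith
  have hκ0 : 0 ≤ κ := by rw [hκ]; positivity
  have pid : PG (fun x : Mat n => x) := PG.clm (ContinuousLinearMap.id ℝ (Mat n))
  have p1 : PG (fun x : Mat n => u ⬝ᵥ x.mulVec u) := pid.clm_comp (bilCLM u u)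
  have p2 : PG (fun x : Mat n => bilCLM u u (x * x)) := (pid.mul pid).clm_comp _
  have p3 : PG (fun x : Mat n => bilCLM u u (x * x * x)) := ((pid.mul pid).mul pid).clm_comp _
  set m := ∫ x, bilCLM u u (x * x) ∂μ with hm
  have p2' : PG (fun x : Mat n => bilCLM u u (x * x) - m) := by
    simp only [sub_eq_add_neg]
    exact p2.add (PG.const (-m))
  have hk : ∀ j : ℕ, 0 < 1 / K ^ j := fun j => by positivity
  have i1 : ∫ x, |u ⬝ᵥ x.mulVec u| ∂μ ≤ c' / K ^ 16 := by
    refine abs_int_le (by positivity) (p1.integrable μ) ((p1.pow 2).integrable μ) ?_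
    refine (h.hκ u u).trans ?_
    rw [hu, mul_one, mul_one, hκ, div_pow, ← pow_mul]
    gcongr
    refine le_trans ?_ hc2
    nlinarith [mul_nonneg hC hA0]
  have h2 : ∫ x, ‖x‖ ^ 2 ∂μ ≤ (2 + A) * K ^ 4 := by
    have h1 : ∫ x, ‖x‖ ^ 2 ∂μ ≤ ∫ x : Mat n, (1 + ‖x‖ ^ 4) ∂μ := by
      refine integral_mono ((PG.nrm 2).integrable μ)
        ((integrable_const _).add ((PG.nrm 4).integrable μ)) fun x => ?_
      simp only
      nlinarith [sq_nonneg (‖x‖ ^ 2 - 1), sq_nonneg (‖x‖ ^ 2)]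
    rw [integral_add (integrable_const _) ((PG.nrm 4).integrable μ)] at h1
    simp only [integral_const, probReal_univ, smul_eq_mul, one_mul] at h1
    have hK4 : 1 ≤ K ^ 4 := one_le_pow₀ hK
    nlinarith
  have i2 : ∫ x, |bilCLM u u (x * x) - m| ∂μ ≤ c' / K ^ 14 := by
    refine abs_int_le (by positivity) (p2'.integrable μ) ((p2'.pow 2).integrable μ) ?_
    refine (gm_var2 h hκ0 u hu).trans ?_
    calc 8 * κ * ∫ x, ‖x‖ ^ 2 ∂μ ≤ 8 * κ * ((2 + A) * K ^ 4) := by gcongr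
      _ = (8 * (2 + C) * (2 + A)) / K ^ 28 := by rw [hκ]; field_simp
      _ ≤ c' ^ 2 / K ^ 28 := by
        gcongr
        refine le_trans ?_ hc2
        nlinarith [mul_nonneg hC hA0]
      _ = _ := by rw [div_pow, ← pow_mul]
  have i3 : ∫ x, |bilCLM u u (x * x * x)| ∂μ ≤ c' / K ^ 14 := by
    refine abs_int_le (by positivity) (p3.integrable μ) ((p3.pow 2).integrable μ) ?_
    refine (gm_var3 h hκ0 u hu).trans ?_
    calc 36 * κ * ∫ x, ‖x‖ ^ 4 ∂μ ≤ 36 * κ * ((1 + A) * K ^ 4) := by gcongr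
      _ = (36 * (2 + C) * (1 + A)) / K ^ 28 := by rw [hκ]; field_simp
      _ ≤ c' ^ 2 / K ^ 28 := by
        gcongr
        refine le_trans ?_ hc2
        nlinarith [mul_nonneg hC hA0]
      _ = _ := by rw [div_pow, ← pow_mul]
  -- the bounding function
  set B : Mat n → ℝ := fun x => (2 * K ^ 9 + 6) * |u ⬝ᵥ x.mulVec u|
    + 2 * K ^ 8 * |bilCLM u u (x * x) - m| + 2 * |bilCLM u u (x * x * x)|
    + (2 * K ^ 8 * (C / K ^ 32) + 9 / K ^ 6 + 3 / K ^ 4) with hB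
  have j1 := (p1.integrable μ).abs.const_mul (2 * K ^ 9 + 6)
  have j2 := (p2'.integrable μ).abs.const_mul (2 * K ^ 8)
  have j3 := (p3.integrable μ).abs.const_mul 2
  have iB : Integrable B μ := ((j1.add j2).add j3).add (integrable_const _)
  have hB0 : ∀ x, 0 ≤ B x := fun x => by positivity
  have hle : ∀ j l : ℕ, l ≤ j → 1 / K ^ j ≤ 1 / K ^ l := fun j l hjl =>
    one_div_le_one_div_of_le (by positivity) (pow_le_pow_right₀ hK hjl)
  have hEB : ∫ x, B x ∂μ ≤ 800 * (2 + C) * (2 + A) / K ^ 4 := by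
    have e : ∫ x, B x ∂μ = (2 * K ^ 9 + 6) * ∫ x, |u ⬝ᵥ x.mulVec u| ∂μ
        + 2 * K ^ 8 * ∫ x, |bilCLM u u (x * x) - m| ∂μ + 2 * ∫ x, |bilCLM u u (x * x * x)| ∂μ
        + (2 * K ^ 8 * (C / K ^ 32) + 9 / K ^ 6 + 3 / K ^ 4) := by
      have j12 : Integrable (fun x : Mat n => (2 * K ^ 9 + 6) * |u ⬝ᵥ x.mulVec u|
          + 2 * K ^ 8 * |bilCLM u u (x * x) - m|) μ := j1.add j2
      have j123 : Integrable (fun x : Mat n => (2 * K ^ 9 + 6) * |u ⬝ᵥ x.mulVec u|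
          + 2 * K ^ 8 * |bilCLM u u (x * x) - m| + 2 * |bilCLM u u (x * x * x)|) μ := j12.add j3
      rw [hB, integral_add j123 (integrable_const _), integral_add j12 j3,
        integral_add j1 j2, integral_const_mul, integral_const_mul, integral_const_mul]
      simp only [integral_const, probReal_univ, smul_eq_mul, one_mul]
    rw [e]
    calc _ ≤ (2 * K ^ 9 + 6) * (c' / K ^ 16) + 2 * K ^ 8 * (c' / K ^ 14) + 2 * (c' / K ^ 14)
        + (2 * K ^ 8 * (C / K ^ 32) + 9 / K ^ 6 + 3 / K ^ 4) := by gcongr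
      _ = 2 * c' * (1 / K ^ 7) + 6 * c' * (1 / K ^ 16) + 2 * c' * (1 / K ^ 6)
        + 2 * c' * (1 / K ^ 14)
        + (2 * C * (1 / K ^ 24) + 9 * (1 / K ^ 6) + 3 * (1 / K ^ 4)) := by field_simp
      _ ≤ 2 * c' * (1 / K ^ 4) + 6 * c' * (1 / K ^ 4) + 2 * c' * (1 / K ^ 4) + 2 * c' * (1 / K ^ 4)
        + (2 * C * (1 / K ^ 4) + 9 * (1 / K ^ 4) + 3 * (1 / K ^ 4)) := by
          gcongr <;> first | exact hle _ _ (by norm_num) | norm_num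
      _ = (12 * c' + 2 * C + 12) * (1 / K ^ 4) := by ring
      _ ≤ (800 * (2 + C) * (2 + A)) * (1 / K ^ 4) := by
          gcongr
          rw [hc']
          nlinarith [mul_nonneg hC hA0]
      _ = _ := by ring
  have hsub : {x | s ≤ |K ^ 16 * (lam1 (x + lam • Matrix.vecMulVec u u) - lam - 1 / lam
        - u ⬝ᵥ x.mulVec u)|} ⊆ ({x | K < ‖x‖} ∪ {x | s ≤ B x}) ∪ {x | ¬ Matrix.IsSymm x} := by
    intro x hx
    by_cases hsy : Matrix.IsSymm x
    swap
    · exact Or.inr hsy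
    left
    rcases lt_or_ge K ‖x‖ with hxK | hxK
    · exact Or.inl hxK
    right
    rw [Set.mem_setOf_eq] at hx
    change s ≤ B x
    refine le_trans hx ?_
    rw [abs_mul, abs_of_pos (by positivity : 0 < K ^ 16)]
    have hexp := lam1_expand hn hsy hu hlam hxK (by linarith)
    have hli : 1 / lam ≤ 1 / K ^ 8 := one_div_le_one_div_of_le (by positivity) hl
    have hli0 : 0 ≤ 1 / lam := by positivity
    have ha2 : |u ⬝ᵥ (x * x).mulVec u - 1| ≤ |bilCLM u u (x * x) - m| + C / K ^ 32 := by
      rw [← bilCLM_apply]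
      calc _ = |(bilCLM u u (x * x) - m) + (m - 1)| := by congr 1; ring
        _ ≤ _ := (abs_add_le _ _).trans (by gcongr)
    rw [← bilCLM_apply u u (x * x * x)] at hexp
    set a1 := |u ⬝ᵥ x.mulVec u|
    set a3 := |bilCLM u u (x * x * x)|
    have ha1 : 0 ≤ a1 := abs_nonneg _
    have ha3 : 0 ≤ a3 := abs_nonneg _
    set l := 1 / lam with hll
    calc _ ≤ K ^ 16 * (2 * K / lam * a1 + 2 / lam * |u ⬝ᵥ (x * x).mulVec u - 1|
          + 3 * (2 * a1 + 3 * K ^ 2 / lam) / lam ^ 2 + 2 / lam ^ 2 * a3 + 3 * K ^ 4 / lam ^ 3) := by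
          gcongr
      _ = K ^ 16 * (2 * K * l * a1 + 2 * l * |u ⬝ᵥ (x * x).mulVec u - 1|
          + 3 * (2 * a1 + 3 * K ^ 2 * l) * l ^ 2 + 2 * l ^ 2 * a3 + 3 * K ^ 4 * l ^ 3) := by
          rw [hll]; field_simp
      _ ≤ K ^ 16 * (2 * K * (1 / K ^ 8) * a1
          + 2 * (1 / K ^ 8) * (|bilCLM u u (x * x) - m| + C / K ^ 32)
          + 3 * (2 * a1 + 3 * K ^ 2 * (1 / K ^ 8)) * (1 / K ^ 8) ^ 2 + 2 * (1 / K ^ 8) ^ 2 * a3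
          + 3 * K ^ 4 * (1 / K ^ 8) ^ 3) := by
          gcongr
      _ = B x := by
          rw [hB]; simp only; field_simp; ring
  have hmk : μ {x | s ≤ B x} ≤ ENNReal.ofReal (800 * (2 + C) * (2 + A) / K ^ 4 / s) := by
    have hmk := mul_meas_ge_le_integral_of_nonneg (μ := μ) (f := B) (ae_of_all _ hB0) iB s
    rw [← ENNReal.ofReal_toReal (measure_ne_top μ {x | s ≤ B x})]
    refine ENNReal.ofReal_le_ofReal ?_
    rw [le_div_iff₀ hs, mul_comm]
    exact hmk.trans hEB
  have hsn : μ {x | ¬ Matrix.IsSymm x} = 0 := h.symm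
  calc _ ≤ μ (({x | K < ‖x‖} ∪ {x | s ≤ B x}) ∪ {x | ¬ Matrix.IsSymm x}) := measure_mono hsub
    _ ≤ (μ {x | K < ‖x‖} + μ {x | s ≤ B x}) + μ {x | ¬ Matrix.IsSymm x} :=
        (measure_union_le _ _).trans (by gcongr; exact measure_union_le _ _)
    _ ≤ ENNReal.ofReal (A / K ^ 4) + ENNReal.ofReal (800 * (2 + C) * (2 + A) / K ^ 4 / s) := by
        rw [hsn, add_zero]; gcongr
    _ = _ := by rw [ENNReal.ofReal_add (by positivity) (by positivity)]
end fin
section limit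
variable {Ω : Type*} [MeasureSpace Ω] [IsProbabilityMeasure (volume : Measure Ω)]

lemma slutsky_bcf {T Y : ℕ → Ω → ℝ} {ν : Measure ℝ} [IsProbabilityMeasure ν]
    (hTm : ∀ n, Measurable (T n)) (hYm : ∀ n, Measurable (Y n))
    (hT : ∀ f : BoundedContinuousFunction ℝ ℝ,
      Tendsto (fun n => ∫ ω, f (T n ω)) atTop (𝓝 (∫ x, f x ∂ν)))
    (hR : ∀ s : ℝ, 0 < s → Tendsto (fun n => (volume : Measure Ω) {ω | s ≤ |Y n ω - T n ω|})
      atTop (𝓝 0)) (f : BoundedContinuousFunction ℝ ℝ) :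
    Tendsto (fun n => ∫ ω, f (Y n ω)) atTop (𝓝 (∫ x, f x ∂ν)) := by
  have hD : TendstoInDistribution T atTop (id : ℝ → ℝ) (fun _ => (volume : Measure Ω)) ν := by
    refine ⟨fun n => (hTm n).aemeasurable, aemeasurable_id, ?_⟩
    refine ProbabilityMeasure.tendsto_iff_forall_integral_tendsto.2 fun g => ?_
    have := hT g
    change Tendsto (fun n => ∫ x, g x ∂(Measure.map (T n) volume)) atTop
      (𝓝 (∫ x, g x ∂(Measure.map id ν)))
    rw [Measure.map_id]
    refine this.congr fun n => ?_
    rw [integral_map (hTm n).aemeasurable g.continuous.aestronglyMeasurable]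
  have hM : TendstoInMeasure (volume : Measure Ω) (Y - T) atTop 0 := by
    rw [tendstoInMeasure_iff_norm]
    intro s hs
    refine (hR s hs).congr fun n => ?_
    simp [Real.norm_eq_abs]
  have h2 := (tendstoInDistribution_of_tendstoInMeasure_sub Y id hD hM
    fun n => (hYm n).aemeasurable).tendsto
  have h3 : Tendsto (fun n => ∫ x, f x ∂(Measure.map (Y n) volume)) atTop
      (𝓝 (∫ x, f x ∂(Measure.map id ν))) :=
    ProbabilityMeasure.tendsto_iff_forall_integral_tendsto.1 h2 f
  rw [Measure.map_id] at h3
  refine h3.congr fun n => ?_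
  rw [integral_map (hYm n).aemeasurable f.continuous.aestronglyMeasurable]

lemma gauss_std (v : NNReal) (f : BoundedContinuousFunction ℝ ℝ) :
    ∫ x, f x ∂(gaussianReal 0 v) = ∫ x, f (Real.sqrt v * x) ∂(gaussianReal 0 1) := by
  have h := gaussianReal_map_const_mul (μ := 0) (v := 1) (Real.sqrt v)
  have h2 : NNReal.mk (Real.sqrt v ^ 2) (sq_nonneg _) * 1 = v := by
    rw [mul_one]; ext; exact Real.sq_sqrt v.2
  rw [mul_zero] at h
  have h3 : gaussianReal 0 v = Measure.map (fun x => Real.sqrt v * x) (gaussianReal 0 1) := by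
    rw [h]; congr 1; exact h2.symm
  rw [h3, integral_map (by fun_prop) f.continuous.aestronglyMeasurable]

lemma gauss_lim {v : ℕ → NNReal} {w : NNReal} (h : Tendsto (fun n => (v n : ℝ)) atTop (𝓝 w))
    (f : BoundedContinuousFunction ℝ ℝ) :
    Tendsto (fun n => ∫ x, f x ∂(gaussianReal 0 (v n))) atTop
      (𝓝 (∫ x, f x ∂(gaussianReal 0 w))) := by
  simp_rw [gauss_std]
  refine tendsto_integral_of_dominated_convergence (fun _ => ‖f‖)
    (fun n => ?_) (integrable_const _) (fun n => ae_of_all _ fun x => f.norm_coe_le_norm _)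
    (ae_of_all _ fun x => ?_)
  · exact (f.continuous.comp (by fun_prop)).aestronglyMeasurable
  · refine (f.continuous.tendsto _).comp ?_
    exact ((Real.continuous_sqrt.tendsto _).comp h).mul_const x

/-- Law of the scaled sum. -/
lemma sum_law {n : ℕ} {X : Ω → Matrix (Fin n) (Fin n) ℝ}
    (hg : IsCenteredGaussianVec fun p : Fin n × Fin n => fun ω => X ω p.1 p.2) (r : ℝ) :
    Measurable (fun ω => r * ((1 / (n:ℝ)) * ∑ i, ∑ j, X ω i j)) ∧
    Measure.map (fun ω => r * ((1 / (n:ℝ)) * ∑ i, ∑ j, X ω i j)) volume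
      = gaussianReal 0 (r ^ 2 * pvar fun ω => (1 / (n:ℝ)) * ∑ i, ∑ j, X ω i j).toNNReal ∧
      0 ≤ pvar fun ω => (1 / (n:ℝ)) * ∑ i, ∑ j, X ω i j := by
  have hmX : ∀ i j, Measurable fun ω => X ω i j := fun i j => hg.1 (i, j)
  set S : Ω → ℝ := fun ω => (1 / (n:ℝ)) * ∑ i, ∑ j, X ω i j with hS
  have hSm : Measurable S := by
    refine Measurable.const_mul ?_ _
    exact Finset.measurable_sum _ fun i _ => Finset.measurable_sum _ fun j _ => hmX i j
  obtain ⟨v, hv⟩ := hg.2 (fun _ => 1 / (n:ℝ))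
  have e : (fun ω => ∑ p : Fin n × Fin n, 1 / (n:ℝ) * X ω p.1 p.2) = S := by
    ext ω
    rw [hS, ← Finset.mul_sum, Fintype.sum_prod_type]
  rw [e] at hv
  have hm0 : ∫ ω, S ω = 0 := by
    have := integral_map hSm.aemeasurable (μ := (volume : Measure Ω)) (f := fun y : ℝ => y)
      (by fun_prop)
    rw [← this, hv, integral_id_gaussianReal]
  have hv2 : ∫ ω, S ω * S ω = v := by
    have := integral_map hSm.aemeasurable (μ := (volume : Measure Ω)) (f := fun y : ℝ => y * y)
      (by fun_prop)
    rw [← this, hv]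
    have h1 := variance_fun_id_gaussianReal (μ := 0) (v := v)
    rw [variance_eq_integral (by fun_prop)] at h1
    simp only [integral_id_gaussianReal, sub_zero, pow_two] at h1
    exact h1
  have hp : pvar S = v := by
    rw [pvar, pcov, hv2, hm0]; simp
  refine ⟨hSm.const_mul r, ?_, by rw [hp]; exact v.2⟩
  have h1 : Measure.map (fun ω => r * S ω) volume
      = Measure.map (fun x => r * x) (Measure.map S volume) := by
    rw [Measure.map_map (by fun_prop) hSm]; rfl
  rw [h1, hv, gaussianReal_map_const_mul, mul_zero, hp]
  congr 1
  ext
  rw [Real.coe_toNNReal _ (by positivity)]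
  simp
end limit

section final
open scoped Matrix.Norms.L2Operator
attribute [local instance] matMS matBorel

variable {Ω : Type*} [MeasureSpace Ω] [IsProbabilityMeasure (volume : Measure Ω)]

lemma remainder_small
    (X : (n : ℕ) → Ω → Matrix (Fin n) (Fin n) ℝ) (C ε : ℝ)
    (hC : 0 < C) (hε : 0 < ε) (hε1 : ε < 1) (hX : CorrGaussian Ω X C ε)
    (lam : ℕ → ℝ)
    (hlam' : Tendsto (fun n : ℕ => lam n / (n : ℝ) ^ (ε / 4)) atTop atTop) (s : ℝ) (hs : 0 < s) :
    Tendsto (fun n : ℕ => (volume : Measure Ω) {ω | s ≤ |(n : ℝ) ^ (ε / 2) *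
          (lam1 (((n : ℝ) ^ (-(1 / 2) : ℝ)) •
              (X n ω + (lam n / Real.sqrt n) • onesMat n)) - lam n - 1 / lam n)
          - (n : ℝ) ^ (ε / 2) * (n : ℝ) ^ (-(1 / 2) : ℝ) *
            ((1 / (n:ℝ)) * ∑ i, ∑ j, X n ω i j)|}) atTop (𝓝 0) := by
  set δ := ε / 32 with hδ
  have hδ0 : 0 < δ := by positivity
  obtain ⟨k, hk⟩ : ∃ k : ℕ, 1 ≤ k ∧ 1 ≤ δ * ((2 * 2 ^ k - 4 : ℕ) : ℝ) := by
    obtain ⟨N, hN⟩ := exists_nat_ge (1 / δ)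
    refine ⟨N + 4, by omega, ?_⟩
    have h1 : N + 4 < 2 ^ (N + 4) := Nat.lt_two_pow_self
    have h2 : N ≤ 2 * 2 ^ (N + 4) - 4 := by omega
    have h3 : (N : ℝ) ≤ ((2 * 2 ^ (N + 4) - 4 : ℕ) : ℝ) := by exact_mod_cast h2
    rw [div_le_iff₀ hδ0] at hN
    calc (1:ℝ) ≤ δ * N := by linarith
      _ ≤ _ := by gcongr
  obtain ⟨hk1, hk⟩ := hk
  set A : ℝ := ((2 * 2 ^ k + 1) * (1 + C)) ^ (2 ^ k) with hA
  have hA0 : 0 ≤ A := by positivity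
  have hKlim : Tendsto (fun n : ℕ => (n:ℝ) ^ δ) atTop atTop :=
    (tendsto_rpow_atTop hδ0).comp tendsto_natCast_atTop_atTop
  have hbound : Tendsto (fun n : ℕ => ENNReal.ofReal (A / ((n:ℝ) ^ δ) ^ 4
      + 800 * (2 + C) * (2 + A) / ((n:ℝ) ^ δ) ^ 4 / s)) atTop (𝓝 0) := by
    have h4 : Tendsto (fun n : ℕ => ((n:ℝ) ^ δ) ^ 4) atTop atTop :=
      (tendsto_pow_atTop (by norm_num)).comp hKlim
    have h5 := (tendsto_const_nhds (x := A)).div_atTop h4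
    have h6 := ((tendsto_const_nhds (x := 800 * (2 + C) * (2 + A))).div_atTop h4).div_const s
    have h7 := ENNReal.tendsto_ofReal (h5.add h6)
    simpa using h7
  refine tendsto_of_tendsto_of_tendsto_of_le_of_le' tendsto_const_nhds hbound
    (Eventually.of_forall fun n => zero_le) ?_
  filter_upwards [hlam'.eventually_ge_atTop 8, eventually_ge_atTop 1] with n hl hn1
  have hn : 0 < n := hn1
  have hn' : (0:ℝ) < n := by exact_mod_cast hn
  have hn1' : (1:ℝ) ≤ n := by exact_mod_cast hn1
  set K := (n:ℝ) ^ δ with hKd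
  have hK : 1 ≤ K := Real.one_le_rpow hn1' hδ0.le
  have hKpow : ∀ j : ℕ, K ^ j = (n:ℝ) ^ (δ * j) := fun j => by
    rw [hKd, ← Real.rpow_natCast, ← Real.rpow_mul hn'.le]
  have hK8 : (n:ℝ) ^ (ε / 4) = K ^ 8 := by rw [hKpow]; congr 1; rw [hδ]; push_cast; ring
  have hK16 : (n:ℝ) ^ (ε / 2) = K ^ 16 := by rw [hKpow]; congr 1; rw [hδ]; push_cast; ring
  have hK32 : (n:ℝ) ^ (-ε) = 1 / K ^ 32 := by
    rw [hKpow, Real.rpow_neg hn'.le, one_div]; congr 2; rw [hδ]; push_cast; ring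
  rw [hK8, le_div_iff₀ (by positivity)] at hl
  have hl1 : K ^ 8 ≤ lam n := by nlinarith [show 0 < K ^ 8 by positivity]
  have hl8 : 8 * K ≤ lam n := by
    have : K ^ 1 ≤ K ^ 8 := pow_le_pow_right₀ hK (by norm_num)
    linarith
  set r := (n:ℝ) ^ (-(1 / 2) : ℝ) with hr
  have hr2 : r ^ 2 = 1 / n := by
    rw [hr, ← Real.rpow_natCast, ← Real.rpow_mul hn'.le]
    norm_num
    rw [Real.rpow_neg_one]
  have hr0 : 0 < r := by positivity
  have hrs : Real.sqrt n * r = 1 := by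
    rw [hr, Real.sqrt_eq_rpow, ← Real.rpow_add hn']; norm_num
  set η := C * (n:ℝ) ^ (-(1 + ε)) with hη
  have hη0 : 0 ≤ η := by positivity
  have hnη : n * η = C / K ^ 32 := by
    have : (n:ℝ) ^ (-(1 + ε)) = (n:ℝ)⁻¹ * (n:ℝ) ^ (-ε) := by
      rw [← Real.rpow_neg_one, ← Real.rpow_add hn']; congr 1; ring
    rw [hη, this, hK32]; field_simp
  obtain ⟨hmeas, hGM, hsec⟩ := law_GM hn hη0 hr2 (hX.symm n) (hX.gauss n) (hX.var_one n)
    (hX.corr_le n)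
  set μ := Measure.map (fun ω => r • X n ω) volume with hμ
  have hK32' : 1 ≤ K ^ 32 := one_le_pow₀ hK
  have hGM' : GM μ (1 + C) ((2 + C) / K ^ 32) := by
    refine hGM.mono ?_ ?_
    · rw [hnη]
      have : C / K ^ 32 ≤ C := div_le_self hC.le hK32'
      linarith
    · rw [hnη, add_div]
      have : (2:ℝ) / n ≤ 2 / K ^ 32 := by
        have : K ^ 32 ≤ n := by
          rw [hKpow]
          calc (n:ℝ) ^ (δ * (32 : ℕ)) ≤ (n:ℝ) ^ (1:ℝ) := by
                apply Real.rpow_le_rpow_of_exponent_le hn1'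
                rw [hδ]; push_cast; linarith
            _ = n := Real.rpow_one _
        gcongr
      linarith
  have hnK : (n:ℝ) ≤ K ^ (2 * 2 ^ k - 4) := by
    rw [hKpow]
    calc (n:ℝ) = (n:ℝ) ^ (1:ℝ) := (Real.rpow_one _).symm
      _ ≤ _ := Real.rpow_le_rpow_of_exponent_le hn1' hk
  obtain ⟨h4, hP⟩ := gm_fourth hGM' (by positivity) k hn hK hk1 hnK hA
  set u : Fin n → ℝ := fun _ => r with hu
  have huu : u ⬝ᵥ u = 1 := by
    simp only [dotProduct, hu, Finset.sum_const, Finset.card_univ, Fintype.card_fin, nsmul_eq_mul,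
      ← pow_two, hr2]
    field_simp
  have hmean : |∫ x, bilCLM u u (x * x) ∂μ - 1| ≤ C / K ^ 32 := by
    have h1 := hsec u
    rw [huu, mul_one, hnη] at h1
    have h2 : ∫ x, bilCLM u u (x * x) ∂μ = ∫ x, (x.mulVec u) ⬝ᵥ (x.mulVec u) ∂μ := by
      refine integral_congr_ae ?_
      filter_upwards [hGM.symm] with x hx
      rw [bilCLM_apply, ← Matrix.mulVec_mulVec, Matrix.dotProduct_mulVec u,
        ← Matrix.mulVec_transpose, hx.eq]
    rw [h2]; exact h1
  have hcore := core_bound hn hGM' hC.le hA0 hK rfl h4 hP huu hmean hl8 hl1 hs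
  refine le_trans (le_of_eq_of_le ?_ (Measure.le_map_apply hmeas.aemeasurable _)) hcore
  congr 1
  ext ω
  simp only [Set.mem_ofPred_eq, Set.preimage_ofPred_eq]
  have e1 : r • (X n ω + (lam n / Real.sqrt n) • onesMat n)
      = r • X n ω + lam n • Matrix.vecMulVec u u := by
    rw [smul_add]
    congr 1
    ext i j
    simp only [Matrix.smul_apply, onesMat, Matrix.of_apply, Matrix.vecMulVec_apply, hu, smul_eq_mul]
    have : Real.sqrt n ≠ 0 := by positivity
    field_simp
    nlinarith
  have e2 : u ⬝ᵥ (r • X n ω).mulVec u = r * ((1 / (n:ℝ)) * ∑ i, ∑ j, X n ω i j) := by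
    rw [Matrix.smul_mulVec, dotProduct_smul, smul_eq_mul]
    congr 1
    simp only [dotProduct, Matrix.mulVec, hu, ← hr2, Finset.mul_sum]
    refine Finset.sum_congr rfl fun i _ => Finset.sum_congr rfl fun j _ => by ring
  rw [e1, e2, hK16]
  have e3 : ∀ a b : ℝ, K ^ 16 * a - K ^ 16 * r * b = K ^ 16 * (a - r * b) := fun a b => by ring
  rw [e3]

lemma lam1_meas {n : ℕ} {X : Ω → Mat n} (hm : ∀ i j, Measurable fun ω => X ω i j)
    (hs : ∀ ω, (X ω).IsSymm) : Measurable fun ω => lam1 (X ω) := by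
  have : (fun ω => lam1 (X ω))
      = (fun A : Mat n => lam1 ((1 / 2 : ℝ) • (A + A.transpose))) ∘ X := by
    ext ω
    simp only [Function.comp]
    rw [(hs ω).eq, ← two_smul ℝ (X ω), smul_smul]
    norm_num
  rw [this]
  exact lam1_symm_cont.measurable.comp (mat_meas hm)
end final

/-- Gaussian fluctuations when `0 < ε < 1`, assuming
`Var((1/n) Σ_{i,j} X_{ij}) = σ² n^{1-ε} (1 + o(1))` and `λ_n ≫ n^{ε/4}`:
`n^{ε/2} (λ₁(n^{-1/2} Y_n) - λ_n - 1/λ_n)` converges in distribution to `N(0, σ²)`. -/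
theorem fluctuations_eps_lt_one
    {Ω : Type*} [MeasureSpace Ω] [IsProbabilityMeasure (volume : Measure Ω)]
    (X : (n : ℕ) → Ω → Matrix (Fin n) (Fin n) ℝ) (C ε : ℝ)
    (hC : 0 < C) (hε : 0 < ε) (hε1 : ε < 1) (hX : CorrGaussian Ω X C ε)
    (lam : ℕ → ℝ) (D : ℝ) (hD : 0 < D)
    (hlam : ∀ n : ℕ, 1 ≤ n → lam n ≤ D * Real.sqrt n)
    (hlam' : Tendsto (fun n : ℕ => lam n / (n : ℝ) ^ (ε / 4)) atTop atTop)
    (σ : ℝ) (hσ : 0 < σ)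
    (hvar : Tendsto
      (fun n : ℕ =>
        (pvar fun ω => (1 / (n : ℝ)) * ∑ i, ∑ j, X n ω i j) / (n : ℝ) ^ (1 - ε))
      atTop (𝓝 (σ ^ 2))) :
    ∀ f : BoundedContinuousFunction ℝ ℝ,
      Tendsto (fun n : ℕ => ∫ ω, f ((n : ℝ) ^ (ε / 2) *
          (lam1 (((n : ℝ) ^ (-(1 / 2) : ℝ)) •
              (X n ω + (lam n / Real.sqrt n) • onesMat n)) - lam n - 1 / lam n)))
        atTop (𝓝 (∫ x, f x ∂(gaussianReal 0 (σ ^ 2).toNNReal))) := by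
  intro f
  have hS := fun n : ℕ => sum_law (hX.gauss n) ((n : ℝ) ^ (ε / 2) * (n : ℝ) ^ (-(1 / 2) : ℝ))
  refine slutsky_bcf (T := fun n ω => (n : ℝ) ^ (ε / 2) * (n : ℝ) ^ (-(1 / 2) : ℝ) *
    ((1 / (n:ℝ)) * ∑ i, ∑ j, X n ω i j)) (fun n => (hS n).1) (fun n => ?_) (fun g => ?_)
    (remainder_small X C ε hC hε hε1 hX lam hlam') f
  · have h1 : Measurable fun ω => lam1 (((n : ℝ) ^ (-(1 / 2) : ℝ)) •
        (X n ω + (lam n / Real.sqrt n) • onesMat n)) := by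
      refine lam1_meas (fun i j => ?_) fun ω => ?_
      · have := (hX.gauss n).1 (i, j)
        simp only [Matrix.smul_apply, Matrix.add_apply, smul_eq_mul]
        exact (this.add_const _).const_mul _
      · have h2 : (onesMat n).transpose = onesMat n := by ext i j; rfl
        rw [Matrix.IsSymm, Matrix.transpose_smul, Matrix.transpose_add, Matrix.transpose_smul,
          (hX.symm n ω).eq, h2]
    exact ((h1.sub_const _).sub_const _).const_mul _
  · have h1 : ∀ n : ℕ, ∫ ω, g ((n : ℝ) ^ (ε / 2) * (n : ℝ) ^ (-(1 / 2) : ℝ) *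
        ((1 / (n:ℝ)) * ∑ i, ∑ j, X n ω i j))
        = ∫ x, g x ∂(gaussianReal 0 (((n : ℝ) ^ (ε / 2) * (n : ℝ) ^ (-(1 / 2) : ℝ)) ^ 2 *
          pvar fun ω => (1 / (n:ℝ)) * ∑ i, ∑ j, X n ω i j).toNNReal) := by
      intro n
      rw [← (hS n).2.1, integral_map (hS n).1.aemeasurable g.continuous.aestronglyMeasurable]
    simp only [h1]
    refine gauss_lim ?_ g
    rw [Real.coe_toNNReal _ (sq_nonneg σ)]
    refine hvar.congr' ?_
    filter_upwards [eventually_ge_atTop 1] with n hn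
    have hn' : (0:ℝ) < n := by exact_mod_cast hn
    rw [Real.coe_toNNReal _ (mul_nonneg (sq_nonneg _) (hS n).2.2)]
    have : ((n : ℝ) ^ (ε / 2) * (n : ℝ) ^ (-(1 / 2) : ℝ)) ^ 2 = ((n : ℝ) ^ (1 - ε))⁻¹ := by
      rw [← Real.rpow_add hn', ← Real.rpow_natCast, ← Real.rpow_mul hn'.le, ← Real.rpow_neg hn'.le]
      congr 1
      push_cast; ring
    rw [this, div_eq_inv_mul]
end

section
/- Under the correlated Gaussian model with parameter ε > 0, define Z_i = Σ_{j=1}^n X_n(i,j). Then there is a constant C' > 0, independent of n, such that Var(Z_i²) ≤ C'·n² for all n and all 1 ≤ i ≤ n. -/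
open MeasureTheory ProbabilityTheory Filter Topology

/-- Fourth moment of a centered Gaussian scales like the square of the variance. -/
lemma aux_fourth (v : NNReal) :
    ∫ x, x ^ 4 ∂(gaussianReal 0 v) = (v : ℝ) ^ 2 * ∫ x, x ^ 4 ∂(gaussianReal 0 1) := by
  have h := gaussianReal_map_const_mul (μ := 0) (v := 1) (Real.sqrt v)
  have h2 : gaussianReal 0 v = (gaussianReal 0 1).map (fun x => Real.sqrt v * x) := by
    rw [h]
    congr 1
    · simp
    · ext
      simp
  rw [h2, integral_map (by fun_prop) (by fun_prop)]
  rw [← integral_const_mul]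
  congr 1
  ext x
  have : Real.sqrt v ^ 2 = (v : ℝ) := Real.sq_sqrt v.2
  calc (Real.sqrt v * x) ^ 4 = (Real.sqrt v ^ 2) ^ 2 * x ^ 4 := by ring
    _ = (v : ℝ) ^ 2 * x ^ 4 := by rw [this]

lemma aux_second (v : NNReal) : ∫ x, x ^ 2 ∂(gaussianReal 0 v) = (v : ℝ) := by
  have h := variance_fun_id_gaussianReal (μ := 0) (v := v)
  rw [variance_eq_integral (by fun_prop)] at h
  simpa using h

lemma aux_row {Ω : Type*} [MeasureSpace Ω] [IsProbabilityMeasure (volume : Measure Ω)]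
    (X : (n : ℕ) → Ω → Matrix (Fin n) (Fin n) ℝ) (C ε : ℝ)
    (hX : CorrGaussian Ω X C ε) (n : ℕ) (i : Fin n) (c : Fin n → ℝ) :
    Measurable (fun ω => ∑ j, c j * X n ω i j) ∧ ∃ v : NNReal,
      Measure.map (fun ω => ∑ j, c j * X n ω i j) (volume : Measure Ω) = gaussianReal 0 v := by
  obtain ⟨hm, hg⟩ := hX.gauss n
  refine ⟨Finset.measurable_sum _ fun j _ => (hm (i, j)).const_mul _, ?_⟩
  obtain ⟨v, hv⟩ := hg (fun p => if p.1 = i then c p.2 else 0)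
  refine ⟨v, ?_⟩
  rw [← hv]
  congr 1
  ext ω
  symm
  rw [Fintype.sum_prod_type, Finset.sum_eq_single i]
  · simp
  · intro b _ hb
    simp [hb]
  · simp

lemma aux_memLp {Ω : Type*} [MeasureSpace Ω] [IsProbabilityMeasure (volume : Measure Ω)]
    (X : (n : ℕ) → Ω → Matrix (Fin n) (Fin n) ℝ) (C ε : ℝ)
    (hX : CorrGaussian Ω X C ε) (n : ℕ) (i j : Fin n) :
    MemLp (fun ω => X n ω i j) 2 (volume : Measure Ω) := by
  obtain ⟨hm, v, hv⟩ := aux_row X C ε hX n i (Pi.single j 1)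
  have e : (fun ω => ∑ k, (Pi.single j 1 : Fin n → ℝ) k * X n ω i k) = fun ω => X n ω i j := by
    ext ω
    simp [Pi.single_apply]
  rw [e] at hm hv
  have h := memLp_id_gaussianReal' (μ := 0) (v := v) 2 (by simp)
  rw [← hv] at h
  exact h.comp_of_map hm.aemeasurable

/-- the squared row sums satisfy `Var(Z_i²) ≤ C' n²`. -/
theorem row_sum_square_var
    {Ω : Type*} [MeasureSpace Ω] [IsProbabilityMeasure (volume : Measure Ω)]
    (X : (n : ℕ) → Ω → Matrix (Fin n) (Fin n) ℝ) (C ε : ℝ)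
    (hC : 0 < C) (hε : 0 < ε) (hX : CorrGaussian Ω X C ε) :
    ∃ C' : ℝ, 0 < C' ∧ ∀ n : ℕ, ∀ i : Fin n,
      pvar (fun ω => (∑ j, X n ω i j) ^ 2) ≤ C' * (n : ℝ) ^ 2 := by
  set K : ℝ := ∫ x, x ^ 4 ∂(gaussianReal 0 1) with hK
  have hK0 : 0 ≤ K := integral_nonneg fun x => by positivity
  refine ⟨(K + 1) * (1 + C) ^ 2, by positivity, ?_⟩
  intro n i
  have hn : 1 ≤ (n : ℝ) := by
    have : 0 < n := i.pos
    exact_mod_cast this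
  obtain ⟨hm, v, hv⟩ := aux_row X C ε hX n i (fun _ => 1)
  simp only [one_mul] at hm hv
  have h2 : ∫ ω, (∑ j, X n ω i j) ^ 2 = (v : ℝ) := by
    rw [← aux_second v, ← hv, integral_map hm.aemeasurable (by fun_prop)]
  have h4 : ∫ ω, (∑ j, X n ω i j) ^ 4 = (v : ℝ) ^ 2 * K := by
    rw [hK, ← aux_fourth v, ← hv, integral_map hm.aemeasurable (by fun_prop)]
  have hint : ∀ j k, Integrable (fun ω => X n ω i j * X n ω i k) (volume : Measure Ω) :=
    fun j k => (aux_memLp X C ε hX n i j).integrable_mul (aux_memLp X C ε hX n i k)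
  have hexp : (v : ℝ) = ∑ j, ∑ k, ∫ ω, X n ω i j * X n ω i k := by
    rw [← h2]
    simp_rw [sq, Finset.sum_mul_sum]
    rw [integral_finsetSum _ fun j _ => integrable_finsetSum _ fun k _ => hint j k]
    refine Finset.sum_congr rfl fun j _ => ?_
    rw [integral_finsetSum _ fun k _ => hint j k]
  have hpow : (n : ℝ) ^ (-(1 + ε)) ≤ (n : ℝ)⁻¹ := by
    rw [← Real.rpow_neg_one]
    exact Real.rpow_le_rpow_of_exponent_le hn (by linarith)
  have hterm : ∀ j k, ∫ ω, X n ω i j * X n ω i k ≤ (if j = k then 1 else 0) + C * (n : ℝ)⁻¹ := by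
    intro j k
    by_cases hjk : j = k
    · subst hjk
      have := hX.var_one n i j
      simp_rw [sq] at this
      rw [this]
      simp
      positivity
    · have := hX.corr_le n i j i k (by
        simp only [Prod.mk.injEq, not_or, not_and]
        exact ⟨fun _ => hjk, fun h1 h2 => hjk (h2.trans h1)⟩)
      have h5 := mul_le_mul_of_nonneg_left hpow hC.le
      simp only [hjk, if_false, zero_add]
      exact (le_abs_self _).trans (this.trans h5)
  have hvb : (v : ℝ) ≤ (1 + C) * n := by
    rw [hexp]
    refine (Finset.sum_le_sum fun j _ => Finset.sum_le_sum fun k _ => hterm j k).trans ?_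
    simp only [Finset.sum_add_distrib, Finset.sum_ite_eq, Finset.mem_univ, if_true,
      Finset.sum_const, Finset.card_univ, Fintype.card_fin, nsmul_eq_mul]
    have : (n : ℝ) ≠ 0 := by positivity
    apply le_of_eq
    field_simp
  have hv0 : (0 : ℝ) ≤ v := v.2
  have hsq : (v : ℝ) ^ 2 ≤ ((1 + C) * n) ^ 2 := by gcongr
  unfold pvar pcov
  have h44 : ∫ ω, (∑ j, X n ω i j) ^ 2 * (∑ j, X n ω i j) ^ 2 = (v : ℝ) ^ 2 * K := by
    rw [← h4]
    congr 1
    ext ω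
    ring
  rw [h44, h2]
  nlinarith [mul_le_mul_of_nonneg_right hsq hK0, sq_nonneg ((1 + C) * n), sq_nonneg (v : ℝ)]
end
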